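/- Fix θ > 0 and an integer m ≥ 1. For all complex numbers y_1, …, y_m ∈ ℂ, the Macdonald–Mehta integral identity holds: 𝔼_{(x_1, …, x_m) ∼ 𝕄^{(θ)}_m}[ 𝓑_{(x_1, …, x_m)}(y_1, …, y_m; θ) ] = exp( (1/(2θ)) ∑_{i=1}^m y_i² ), where the expectation is over the Gaussian beta ensemble 𝕄^{(θ)}_m and the Bessel function of the random point is defined almost surely (the point is almost surely strictly ordered). -/

import Mathlib

open MeasureTheory Filter Topology
open scoped ENNReal

noncomputable section

/-- A triangular array with `M` levels: for `k : Fin M`, level `k+1` has `k+1` real entries. -/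
abbrev Tri (M : ℕ) := ∀ k : Fin M, Fin (k.1 + 1) → ℝ

/-- `Interlaces u v` means `u ≺ v`, i.e. `v 1 > u 1 > v 2 > u 2 > ⋯ > v n > u n > v (n+1)`. -/
def Interlaces {n : ℕ} (u : Fin n → ℝ) (v : Fin (n + 1) → ℝ) : Prop :=
  ∀ i : Fin n, u i < v i.castSucc ∧ v i.succ < u i

/-- Level `k+1` (for `k < N`) of the configuration consisting of the triangular array `x`
(levels `1, …, N-1`) together with the top level `a` (level `N`). -/
def lvl {N : ℕ} (a : Fin N → ℝ) (x : Tri (N - 1)) (k : ℕ) (hk : k < N) :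
    Fin (k + 1) → ℝ :=
  if h : k < N - 1 then fun i => x ⟨k, h⟩ i
  else fun i => a ⟨i.1, by have := i.isLt; omega⟩

/-- The (unnormalized) density of the orbital beta process with top level `a`. -/
def obpWt (θ : ℝ) {N : ℕ} (a : Fin N → ℝ) (x : Tri (N - 1)) : ℝ :=
  ∏ k : Fin (N - 1),
    ((∏ i : Fin (k.1 + 1), ∏ j : Fin (k.1 + 1),
        if i < j then |x k i - x k j| ^ (2 - 2 * θ) else 1) *
      ∏ s : Fin (k.1 + 2), ∏ r : Fin (k.1 + 1),
        |lvl a x (k.1 + 1) (by have := k.isLt; omega) s - x k r| ^ (θ - 1))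

/-- The interlacing scheme `𝒫(a)`: arrays `(a⁽¹⁾ ≺ a⁽²⁾ ≺ ⋯ ≺ a⁽ᴺ⁻¹⁾ ≺ a)`. -/
def obpDomain {N : ℕ} (a : Fin N → ℝ) : Set (Tri (N - 1)) :=
  {x | ∀ k : Fin (N - 1),
      Interlaces (x k) (lvl a x (k.1 + 1) (by have := k.isLt; omega))}

/-- The orbital beta process `𝕄^{a,θ}` with top level `a`. -/
def obp (θ : ℝ) {N : ℕ} (a : Fin N → ℝ) : Measure (Tri (N - 1)) :=
  (ENNReal.ofReal (∫ x in obpDomain a, obpWt θ a x))⁻¹ •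
    volume.withDensity fun x =>
      ENNReal.ofReal ((obpDomain a).indicator (obpWt θ a) x)

/-- The Weyl chamber `𝒲_m = {x : x 0 ≥ x 1 ≥ ⋯}`. -/
def weylChamber (m : ℕ) : Set (Fin m → ℝ) :=
  {x | ∀ i j : Fin m, i ≤ j → x j ≤ x i}

/-- The (unnormalized) density of the Gaussian beta ensemble. -/
def gbeWt (θ : ℝ) (m : ℕ) (x : Fin m → ℝ) : ℝ :=
  (∏ i : Fin m, ∏ j : Fin m, if i < j then |x i - x j| ^ (2 * θ) else 1) *
    Real.exp (-(θ / 2) * ∑ i, x i ^ 2)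

/-- The Gaussian beta ensemble `𝕄^{(θ)}_m` of rank `m`. -/
def gbe (θ : ℝ) (m : ℕ) : Measure (Fin m → ℝ) :=
  (ENNReal.ofReal (∫ x in weylChamber m, gbeWt θ m x))⁻¹ •
    volume.withDensity fun x =>
      ENNReal.ofReal ((weylChamber m).indicator (gbeWt θ m) x)

/-- The empirical measure `μ_N = (1/N) ∑ δ_{a_i/N}`. -/
def empMeasure {N : ℕ} (a : Fin N → ℝ) : Measure ℝ :=
  ((N : ℝ≥0∞))⁻¹ • ∑ i : Fin N, Measure.dirac (a i / N)

/-- The mean `𝔼[ν]` of a measure on `ℝ`. -/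
def meanM (ν : Measure ℝ) : ℝ := ∫ t, t ∂ν

/-- The variance `Var[ν]` of a measure on `ℝ`. -/
def varM (ν : Measure ℝ) : ℝ := (∫ t, t ^ 2 ∂ν) - meanM ν ^ 2

/-- A regular sequence of ordered tuples with limiting measure `μ`. -/
def RegularSeq (a : (N : ℕ) → Fin N → ℝ) (μ : Measure ℝ) : Prop :=
  (∀ N : ℕ, 1 ≤ N → StrictAnti (a N)) ∧
  (∃ C : ℝ, ∀ N : ℕ, ∀ hN : 1 ≤ N,
      |a N ⟨0, by omega⟩| ≤ C * N ∧ |a N ⟨N - 1, by omega⟩| ≤ C * N) ∧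
  IsProbabilityMeasure μ ∧
  (∃ R : ℝ, μ {t : ℝ | |t| ≤ R}ᶜ = 0) ∧
  ∀ f : BoundedContinuousFunction ℝ ℝ,
    Tendsto (fun N : ℕ => ∫ t, f t ∂empMeasure (a N)) atTop (𝓝 (∫ t, f t ∂μ))

/-- Projection of a triangular array (with top level of size `N`) to its `m`-th level. -/
def levelProj {N : ℕ} (m : ℕ) (h1 : 1 ≤ m) (h2 : m < N) (x : Tri (N - 1)) :
    Fin m → ℝ :=
  fun i => x ⟨m - 1, by omega⟩ ⟨i.1, (by have := i.isLt; omega : i.1 < m - 1 + 1)⟩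

/-- Projection of a triangular array to its bottom `m` levels. -/
def triProj {N : ℕ} (m : ℕ) (h : m < N) (x : Tri (N - 1)) : Tri m :=
  fun k i => x ⟨k.1, by have := k.isLt; omega⟩ ⟨i.1, i.isLt⟩

/-- The top level of a triangular array with `m` levels. -/
def topLvl {m : ℕ} (hm : 1 ≤ m) (x : Tri m) : Fin m → ℝ :=
  fun i => x ⟨m - 1, by omega⟩ ⟨i.1, (by have := i.isLt; omega : i.1 < m - 1 + 1)⟩

/-- The Gelfand–Tsetlin polytope `𝒲_{m,corners}` (weak interlacing). -/
def gtPoly (m : ℕ) : Set (Tri m) :=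
  {x | ∀ k : Fin m, ∀ hk : k.1 + 1 < m, ∀ i : Fin (k.1 + 1),
      x k i ≤ x ⟨k.1 + 1, hk⟩ i.castSucc ∧ x ⟨k.1 + 1, hk⟩ i.succ ≤ x k i}

/-- Unnormalized density of the Gaussian beta corners process with `m` levels. -/
def gbcWt (θ : ℝ) {m : ℕ} (hm : 1 ≤ m) (x : Tri m) : ℝ :=
  (∏ i : Fin m, ∏ j : Fin m,
      if i < j then topLvl hm x i - topLvl hm x j else 1) *
    Real.exp (-(θ / 2) * ∑ i, topLvl hm x i ^ 2) *
    ∏ k : Fin (m - 1),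
      ((∏ i : Fin (k.1 + 1), ∏ j : Fin (k.1 + 1),
          if i < j then
            |x ⟨k.1, by have := k.isLt; omega⟩ i -
              x ⟨k.1, by have := k.isLt; omega⟩ j| ^ (2 - 2 * θ)
          else 1) *
        ∏ i : Fin (k.1 + 1), ∏ j : Fin (k.1 + 2),
          |x ⟨k.1, by have := k.isLt; omega⟩ i -
            x ⟨k.1 + 1, by have := k.isLt; omega⟩ j| ^ (θ - 1))

/-- The Gaussian beta corners process `𝕄^{(θ)}_{m,corners}`. -/
def gbc (θ : ℝ) {m : ℕ} (hm : 1 ≤ m) : Measure (Tri m) :=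
  (ENNReal.ofReal (∫ x in gtPoly m, gbcWt θ hm x))⁻¹ •
    volume.withDensity fun x =>
      ENNReal.ofReal ((gtPoly m).indicator (gbcWt θ hm) x)

/-- Strict interlacing domain `x⁽¹⁾ ≺ x⁽²⁾ ≺ ⋯ ≺ x⁽ᵐ⁾` inside `Tri m`. -/
def triDomain (m : ℕ) : Set (Tri m) :=
  {x | ∀ k : Fin m, ∀ hk : k.1 + 1 < m, Interlaces (x k) (x ⟨k.1 + 1, hk⟩)}

/-- The θ-Gibbs conditional density of the bottom `n` levels given level `n+1`. -/
def gibbsWt (θ : ℝ) (n : ℕ) (x : Tri (n + 1)) : ℝ :=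
  ((∏ k : Fin (n + 1), Real.Gamma ((k.1 + 1) * θ)) /
      Real.Gamma θ ^ ((n + 1) * (n + 2) / 2)) *
    (∏ i : Fin (n + 1), ∏ j : Fin (n + 1),
      if i < j then
        (x ⟨n, Nat.lt_succ_self n⟩ i - x ⟨n, Nat.lt_succ_self n⟩ j) ^ (1 - 2 * θ)
      else 1) *
    ∏ k : Fin n,
      ((∏ i : Fin (k.1 + 1), ∏ j : Fin (k.1 + 1),
          if i < j then
            (x ⟨k.1, by have := k.isLt; omega⟩ i -
              x ⟨k.1, by have := k.isLt; omega⟩ j) ^ (2 - 2 * θ)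
          else 1) *
        ∏ i : Fin (k.1 + 1), ∏ j : Fin (k.1 + 2),
          |x ⟨k.1, by have := k.isLt; omega⟩ i -
            x ⟨k.1 + 1, by have := k.isLt; omega⟩ j| ^ (θ - 1))

/-- `|a⁽ᵏ⁾|`, the sum of the entries of level `k` (with `a⁽⁰⁾ := 0` and `a⁽ᴺ⁾ := a`). -/
def sumLvl {N : ℕ} (a : Fin N → ℝ) (x : Tri (N - 1)) (k : ℕ) : ℝ :=
  if k = 0 then 0
  else if h : k - 1 < N - 1 then ∑ i, x ⟨k - 1, h⟩ i
  else ∑ i, a i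

/-- The multivariate Bessel function `𝓑_a(y; θ)`, defined through its combinatorial
integral representation over the interlacing scheme with top level `a`. -/
def MBF (θ : ℝ) {N : ℕ} (a : Fin N → ℝ) (y : Fin N → ℂ) : ℂ :=
  ((((∏ k : Fin N, Real.Gamma ((k.1 + 1) * θ)) /
        Real.Gamma θ ^ (N * (N + 1) / 2)) : ℝ) : ℂ) *
    (((∏ i : Fin N, ∏ j : Fin N,
        if i < j then |a i - a j| ^ (1 - 2 * θ) else 1) : ℝ) : ℂ) *
    ∫ x in obpDomain a,
      Complex.exp (∑ k : Fin N,
        y k * ((sumLvl a x (k.1 + 1) - sumLvl a x k.1 : ℝ) : ℂ)) *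
      ((obpWt θ a x : ℝ) : ℂ)

/-- Padding of an `m`-tuple with `N - m` zeros: `(y_1, …, y_m, 0^{N-m})`. -/
def padC {m N : ℕ} (_h : m ≤ N) (y : Fin m → ℂ) : Fin N → ℂ :=
  fun k => if h' : k.1 < m then y ⟨k.1, h'⟩ else 0

/-- Integrand `exp(yz) ∏ (z - a_i)^{-θ}` of the left-directed contour integral,
with `w^{-θ} := exp(-θ Log w)` for the principal branch `Log`. -/
def contourFnL (θ : ℝ) {N : ℕ} (a : Fin N → ℝ) (y z : ℂ) : ℂ :=
  Complex.exp (y * z) *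
    ∏ i : Fin N, Complex.exp (-(θ : ℂ) * Complex.log (z - (a i : ℂ)))

/-- Integrand `exp(-yz) ∏ (a_i - z)^{-θ}` of the right-directed contour integral. -/
def contourFnR (θ : ℝ) {N : ℕ} (a : Fin N → ℝ) (y z : ℂ) : ℂ :=
  Complex.exp (-y * z) *
    ∏ i : Fin N, Complex.exp (-(θ : ℂ) * Complex.log ((a i : ℂ) - z))

/-- `(y_1, …, y_m, y_{m+1})` with `y_{m+1} := y - (z_1 + ⋯ + z_m)`. -/
def Yext {m : ℕ} (ys : Fin m → ℝ) (y : ℝ) (z : Fin m → ℝ) : Fin (m + 1) → ℝ :=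
  fun j => if h : j.1 < m then ys ⟨j.1, h⟩ else y - ∑ i, z i

/-- `(z_1, …, z_m, z_{m+1})` with `z_{m+1} := 0`. -/
def Zext {m : ℕ} (z : Fin m → ℝ) : Fin (m + 1) → ℝ :=
  fun j => if h : j.1 < m then z ⟨j.1, h⟩ else 0

/-- The function `G_{θ, y_1, …, y_m, y}(z_1, …, z_m)`. -/
def Gfn (θ : ℝ) {m : ℕ} (ys : Fin m → ℝ) (y : ℝ) (z : Fin m → ℝ) : ℝ :=
  (∏ i : Fin m, ∏ j : Fin m,
      if i < j then (ys i - ys j + z i) ^ (θ - 1) else 1) *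
    ∏ i : Fin (m + 1), ∏ j : Fin (m + 1),
      if i < j then
        (Yext ys y z i - Yext ys y z j + Zext z i - Zext z j) *
          (Yext ys y z i - Yext ys y z j - Zext z j) ^ (θ - 1)
      else 1

/-- The function `F_{y_1, …, y_m, y}(z_1, …, z_m)`. -/
def Ffn {m : ℕ} (ys : Fin m → ℝ) (y : ℝ) (z : Fin m → ℝ) : ℝ :=
  (1 - (∑ i, z i) / y) * ∏ i, (1 + z i / ys i)


/-- The absolute value of the Vandermonde determinant of `v`. -/
def vdm {n : ℕ} (v : Fin n → ℝ) : ℝ :=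
  ∏ i : Fin n, ∏ j : Fin n, if i < j then |v i - v j| else 1

lemma vdm_nonneg {n : ℕ} (v : Fin n → ℝ) : 0 ≤ vdm v :=
  Finset.prod_nonneg fun i _ => Finset.prod_nonneg fun j _ => by split_ifs <;> positivity

lemma vdm_pos {n : ℕ} {v : Fin n → ℝ} (hv : Function.Injective v) : 0 < vdm v := by
  refine Finset.prod_pos fun i _ => Finset.prod_pos fun j _ => ?_
  split_ifs with h
  · exact abs_pos.2 (sub_ne_zero.2 (hv.ne h.ne))
  · exact one_pos

lemma prod_rpow_eq_vdm_rpow {n : ℕ} (v : Fin n → ℝ) (e : ℝ) :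
    (∏ i : Fin n, ∏ j : Fin n, if i < j then |v i - v j| ^ e else 1) = vdm v ^ e := by
  rw [vdm, ← Real.finsetProd_rpow _ _
    fun i _ => Finset.prod_nonneg fun j _ => by split_ifs <;> positivity]
  refine Finset.prod_congr rfl fun i _ => ?_
  rw [← Real.finsetProd_rpow _ _ fun j _ => by split_ifs <;> positivity]
  refine Finset.prod_congr rfl fun j _ => ?_
  split_ifs <;> simp

lemma prod_Ioi_eq_ite {n : ℕ} (f : Fin n → Fin n → ℝ) :
    ∏ i, ∏ j ∈ Finset.Ioi i, f i j = ∏ i, ∏ j, if i < j then f i j else 1 := by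
  refine Finset.prod_congr rfl fun i _ => ?_
  rw [← Finset.prod_filter]
  congr 1
  ext j
  simp

lemma abs_det_vandermonde {n : ℕ} (v : Fin n → ℝ) : |(Matrix.vandermonde v).det| = vdm v := by
  rw [Matrix.det_vandermonde, prod_Ioi_eq_ite, Finset.abs_prod, vdm]
  refine Finset.prod_congr rfl fun i _ => ?_
  rw [Finset.abs_prod]
  refine Finset.prod_congr rfl fun j _ => ?_
  split_ifs
  · exact abs_sub_comm _ _
  · simp

lemma prod_prod_erase_eq_vdm_sq {n : ℕ} (v : Fin n → ℝ) :
    ∏ i, ∏ j ∈ Finset.univ.erase i, |v i - v j| = vdm v ^ 2 := by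
  have h : ∀ i, ∏ j ∈ Finset.univ.erase i, |v i - v j| =
      (∏ j, if i < j then |v i - v j| else 1) * ∏ j, if j < i then |v j - v i| else 1 := by
    intro i
    rw [← Finset.prod_mul_distrib, ← Finset.mul_prod_erase Finset.univ _ (Finset.mem_univ i)]
    simp only [lt_irrefl, if_false, mul_one, one_mul]
    refine Finset.prod_congr rfl fun j hj => ?_
    rcases lt_or_gt_of_ne (Finset.ne_of_mem_erase hj) with h | h
    · simp [h, h.not_gt, abs_sub_comm]
    · simp [h, h.not_gt]
  simp_rw [h]
  rw [Finset.prod_mul_distrib, sq]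
  congr 1
  rw [Finset.prod_comm]
  rfl

/-- The polynomial with simple roots at the entries of `v`, except the `s`-th one. -/
def cofactorPoly {n : ℕ} (v : Fin n → ℝ) (s : Fin n) : Polynomial ℝ :=
  ∏ j ∈ Finset.univ.erase s, (Polynomial.X - Polynomial.C (v j))

/-- The monic polynomial whose roots are the entries of `v`. -/
def rootPoly {n : ℕ} (v : Fin n → ℝ) : Polynomial ℝ :=
  ∏ j, (Polynomial.X - Polynomial.C (v j))

lemma cofactorPoly_eval {n : ℕ} (v : Fin n → ℝ) (s : Fin n) (x : ℝ) :
    (cofactorPoly v s).eval x = ∏ j ∈ Finset.univ.erase s, (x - v j) := by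
  simp [cofactorPoly, Polynomial.eval_prod]

lemma rootPoly_eval {n : ℕ} (v : Fin n → ℝ) (x : ℝ) :
    (rootPoly v).eval x = ∏ j, (x - v j) := by
  simp [rootPoly, Polynomial.eval_prod]

lemma cofactorPoly_eval_of_ne {n : ℕ} (v : Fin n → ℝ) {r s : Fin n} (h : r ≠ s) :
    (cofactorPoly v s).eval (v r) = 0 := by
  rw [cofactorPoly_eval]
  exact Finset.prod_eq_zero (Finset.mem_erase.2 ⟨h, Finset.mem_univ _⟩) (sub_self _)

lemma cofactorPoly_monic {n : ℕ} (v : Fin n → ℝ) (s : Fin n) : (cofactorPoly v s).Monic :=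
  Polynomial.monic_prod_X_sub_C _ _

lemma rootPoly_monic {n : ℕ} (v : Fin n → ℝ) : (rootPoly v).Monic :=
  Polynomial.monic_prod_X_sub_C _ _

lemma cofactorPoly_natDegree {n : ℕ} (v : Fin n → ℝ) (s : Fin n) :
    (cofactorPoly v s).natDegree = n - 1 := by
  rw [cofactorPoly, Polynomial.natDegree_finsetProd_X_sub_C_eq_card]
  simp

lemma rootPoly_natDegree {n : ℕ} (v : Fin n → ℝ) : (rootPoly v).natDegree = n := by
  rw [rootPoly, Polynomial.natDegree_finsetProd_X_sub_C_eq_card]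
  simp

/-- Determinant of the matrix of values of the cofactor polynomials of `v` at nodes of the
projective line, each node being either a real number `a r` or the point at infinity. -/
lemma abs_det_cofactor {n : ℕ} {v a b : Fin n → ℝ} (hv : Function.Injective v)
    (hab : ∀ r, b r = 1 ∨ (a r = 1 ∧ b r = 0)) :
    |(Matrix.of fun r s => ∏ j ∈ Finset.univ.erase s, (a r - b r * v j)).det| =
      |(Matrix.projVandermonde a b).det| * vdm v := by
  set B : Matrix (Fin n) (Fin n) ℝ := Matrix.of fun k s => (cofactorPoly v s).coeff k
  have hdeg : ∀ s : Fin n, (cofactorPoly v s).natDegree < n := fun s => by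
    have := s.isLt
    rw [cofactorPoly_natDegree]
    omega
  have hJ : (Matrix.of fun r s => ∏ j ∈ Finset.univ.erase s, (a r - b r * v j)) =
      Matrix.projVandermonde a b * B := by
    ext r s
    simp only [Matrix.mul_apply, Matrix.of_apply, Matrix.projVandermonde_apply, B]
    rcases hab r with h | ⟨h1, h2⟩
    · simp only [h, one_mul, one_pow, mul_one]
      rw [← cofactorPoly_eval, Polynomial.eval_eq_sum_range' (hdeg s),
        ← Fin.sum_univ_eq_sum_range fun k => (cofactorPoly v s).coeff k * a r ^ k]
      exact Finset.sum_congr rfl fun k _ => mul_comm _ _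
    · have hn : 0 < n := s.pos
      rw [Finset.sum_eq_single ⟨n - 1, by omega⟩]
      · have h := cofactorPoly_monic v s
        rw [Polynomial.Monic, Polynomial.leadingCoeff, cofactorPoly_natDegree] at h
        simp [h1, h2, h, Fin.val_rev, Nat.sub_add_cancel hn]
      · intro k _ hk
        have : k.rev.1 ≠ 0 := by
          have := k.isLt
          have h3 : k.1 ≠ n - 1 := fun h => hk (Fin.ext h)
          rw [Fin.val_rev]
          omega
        rw [h2, zero_pow this, mul_zero, zero_mul]
      · simp
  have hD : Matrix.vandermonde v * B =
      Matrix.diagonal fun s => ∏ j ∈ Finset.univ.erase s, (v s - v j) := by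
    ext r s
    simp only [Matrix.mul_apply, Matrix.of_apply, Matrix.vandermonde_apply, B]
    have : ∑ k : Fin n, v r ^ (k : ℕ) * (cofactorPoly v s).coeff k =
        (cofactorPoly v s).eval (v r) := by
      rw [Polynomial.eval_eq_sum_range' (hdeg s),
        ← Fin.sum_univ_eq_sum_range fun k => (cofactorPoly v s).coeff k * v r ^ k]
      exact Finset.sum_congr rfl fun k _ => mul_comm _ _
    rw [this, Matrix.diagonal_apply]
    split_ifs with h
    · rw [h, cofactorPoly_eval]
    · exact cofactorPoly_eval_of_ne v h
  have hD' := congrArg (fun M => |Matrix.det M|) hD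
  simp only [Matrix.det_mul, abs_mul, abs_det_vandermonde, Matrix.det_diagonal,
    Finset.abs_prod, prod_prod_erase_eq_vdm_sq] at hD'
  have hB : |B.det| = vdm v := by
    have := vdm_pos hv
    rw [sq] at hD'
    exact mul_left_cancel₀ this.ne' hD'
  rw [hJ, Matrix.det_mul, abs_mul, hB]

lemma abs_det_projVandermonde_snoc {n : ℕ} (u : Fin n → ℝ) :
    |(Matrix.projVandermonde (Fin.snoc u 1 : Fin (n + 1) → ℝ) (Fin.snoc 1 0)).det| = vdm u := by
  rw [Matrix.det_projVandermonde, prod_Ioi_eq_ite, Finset.abs_prod, vdm, Fin.prod_univ_castSucc]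
  simp_rw [Finset.abs_prod]
  rw [Finset.prod_eq_one (s := Finset.univ) (f := fun j => |if Fin.last n < j then _ else _|)]
  · rw [mul_one]
    refine Finset.prod_congr rfl fun i _ => ?_
    rw [Fin.prod_univ_castSucc]
    simp only [Fin.snoc_castSucc, Fin.snoc_last, Fin.castSucc_lt_last, if_true, Fin.castSucc_lt_castSucc_iff,
      Pi.one_apply, mul_one, mul_zero, sub_zero, abs_one]
    refine Finset.prod_congr rfl fun j _ => ?_
    split_ifs
    · exact abs_sub_comm _ _
    · simp
  · intro j _
    rw [if_neg (Fin.le_last j).not_gt, abs_one]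

/-- Sign of a product of differences from `x`, when `x` lies below the first `k` entries and above
the other ones. -/
lemma neg_one_pow_mul_prod_pos {n k : ℕ} (hk : k ≤ n) {b : Fin n → ℝ} {x : ℝ}
    (h₁ : ∀ j : Fin n, j.1 < k → x < b j) (h₂ : ∀ j : Fin n, k ≤ j.1 → b j < x) :
    0 < (-1) ^ k * ∏ j, (x - b j) := by
  have : (-1 : ℝ) ^ k = ∏ j : Fin n, if j.1 < k then (-1) else 1 := by
    rw [Fin.prod_univ_eq_prod_range (fun j => if j < k then (-1 : ℝ) else 1), Finset.prod_ite]
    simp only [Finset.prod_const, one_pow, mul_one]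
    congr
    have : Finset.filter (fun j => j < k) (Finset.range n) = Finset.range k := by
      ext j; simp only [Finset.mem_filter, Finset.mem_range]; omega
    rw [this, Finset.card_range]
  rw [this, ← Finset.prod_mul_distrib]
  refine Finset.prod_pos fun j _ => ?_
  split_ifs with h
  · linarith [h₁ j h]
  · linarith [h₂ j (not_lt.1 h)]

lemma neg_one_pow_mul_prod_erase_pos {n : ℕ} {u : Fin n → ℝ} (hu : StrictAnti u) (r : Fin n) :
    0 < (-1) ^ r.1 * ∏ j ∈ Finset.univ.erase r, (u r - u j) := by
  have : (-1 : ℝ) ^ r.1 = ∏ j ∈ Finset.univ.erase r, if j.1 < r.1 then (-1) else 1 := by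
    have h := Finset.mul_prod_erase Finset.univ
      (fun j : Fin n => if j.1 < r.1 then (-1 : ℝ) else 1) (Finset.mem_univ r)
    simp only [lt_irrefl, if_false, one_mul] at h
    rw [h, Fin.prod_univ_eq_prod_range (fun j => if j < r.1 then (-1 : ℝ) else 1), Finset.prod_ite]
    simp only [Finset.prod_const, one_pow, mul_one]
    congr
    have : Finset.filter (fun j => j < r.1) (Finset.range n) = Finset.range r.1 := by
      ext j; simp only [Finset.mem_filter, Finset.mem_range]; omega
    rw [this, Finset.card_range]
  rw [this, ← Finset.prod_mul_distrib]
  refine Finset.prod_pos fun j hj => ?_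
  split_ifs with h
  · linarith [hu (show j < r from h)]
  · linarith [hu (lt_of_le_of_ne (not_lt.1 h) (Finset.ne_of_mem_erase hj).symm : r < j)]

lemma Interlaces.strictAnti_right {n : ℕ} {u : Fin n → ℝ} {v : Fin (n + 1) → ℝ}
    (h : Interlaces u v) : StrictAnti v :=
  Fin.strictAnti_iff_succ_lt.2 fun i => (h i).2.trans (h i).1

lemma Interlaces.lt_of_le {n : ℕ} {u : Fin n → ℝ} {v : Fin (n + 1) → ℝ}
    (h : Interlaces u v) {i : Fin n} {j : Fin (n + 1)} (hij : j ≤ i.castSucc) : u i < v j :=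
  (h i).1.trans_le (h.strictAnti_right.antitone hij)

lemma Interlaces.lt_of_lt {n : ℕ} {u : Fin n → ℝ} {v : Fin (n + 1) → ℝ}
    (h : Interlaces u v) {i : Fin n} {j : Fin (n + 1)} (hij : i.castSucc < j) : v j < u i :=
  (h.strictAnti_right.antitone (Fin.castSucc_lt_iff_succ_le.1 hij)).trans_lt (h i).2

lemma Interlaces.strictAnti_left {n : ℕ} {u : Fin n → ℝ} {v : Fin (n + 1) → ℝ}
    (h : Interlaces u v) : StrictAnti u := fun i j hij =>
  (h.lt_of_le (i := j) (j := i.succ) (Fin.le_def.2 (Nat.succ_le_of_lt hij))).trans (h i).2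

/-- A monic polynomial of degree `n` with alternating signs at `n + 1` points is the root
polynomial of an interlacing tuple. -/
lemma exists_interlaces_rootPoly {n : ℕ} {t : Fin (n + 1) → ℝ} (ht : StrictAnti t)
    {P : Polynomial ℝ} (hP : P.Monic) (hdeg : P.natDegree = n)
    (hsign : ∀ k : Fin (n + 1), 0 < (-1) ^ k.1 * P.eval (t k)) :
    ∃ v : Fin n → ℝ, Interlaces v t ∧ rootPoly v = P := by
  have hroot : ∀ i : Fin n, ∃ x, t i.succ < x ∧ x < t i.castSucc ∧ P.eval x = 0 := by
    intro i
    have hlt := ht (Fin.castSucc_lt_succ (i := i))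
    have h₁ := hsign i.castSucc
    have h₂ := hsign i.succ
    simp only [Fin.val_castSucc, Fin.val_succ, pow_succ] at h₁ h₂
    have hcont : ContinuousOn (fun x => (-1 : ℝ) ^ i.1 * P.eval x)
        (Set.Icc (t i.succ) (t i.castSucc)) := by fun_prop
    obtain ⟨x, hx, hx0⟩ := intermediate_value_Ioo hlt.le hcont
      (show (0 : ℝ) ∈ Set.Ioo _ _ from ⟨by linarith, h₁⟩)
    refine ⟨x, hx.1, hx.2, ?_⟩
    simpa using hx0
  choose v hv₁ hv₂ hv₃ using hroot
  have hInt : Interlaces v t := fun i => ⟨hv₂ i, hv₁ i⟩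
  refine ⟨v, hInt, ?_⟩
  have hd : (rootPoly v).degree = P.degree := by
    rw [Polynomial.degree_eq_natDegree (rootPoly_monic v).ne_zero,
      Polynomial.degree_eq_natDegree hP.ne_zero, rootPoly_natDegree, hdeg]
  refine Polynomial.eq_of_degree_le_of_eval_index_eq (v := v) Finset.univ
    hInt.strictAnti_left.injective.injOn ?_ hd ((rootPoly_monic v).trans hP.symm) fun i _ => ?_
  · rw [Polynomial.degree_eq_natDegree (rootPoly_monic v).ne_zero, rootPoly_natDegree]
    simp
  · rw [hv₃, rootPoly_eval]
    exact Finset.prod_eq_zero (Finset.mem_univ i) (sub_self _)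

lemma rootPoly_injOn {n : ℕ} {v w : Fin n → ℝ} (hv : StrictAnti v) (hw : StrictAnti w)
    (h : rootPoly v = rootPoly w) : v = w := by
  refine (StrictAnti.range_inj hv hw).1 ?_
  have key : ∀ v : Fin n → ℝ, Set.range v = {x | (rootPoly v).eval x = 0} := by
    intro v
    ext x
    simp only [Set.mem_range, Set.mem_ofPred_eq, rootPoly_eval, Finset.prod_eq_zero_iff,
      Finset.mem_univ, true_and, sub_eq_zero]
    exact exists_congr fun _ => eq_comm
  rw [key v, key w, h]

lemma coeff_X_sq_mul_prod {ι : Type*} [DecidableEq ι] (a : ι → ℝ) (S : Finset ι) :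
    (Polynomial.X ^ 2 * ∏ i ∈ S, (Polynomial.X - Polynomial.C (a i))).coeff (S.card + 2) = 1 ∧
    (Polynomial.X ^ 2 * ∏ i ∈ S, (Polynomial.X - Polynomial.C (a i))).coeff (S.card + 1) =
      -∑ i ∈ S, a i ∧
    2 * (Polynomial.X ^ 2 * ∏ i ∈ S, (Polynomial.X - Polynomial.C (a i))).coeff S.card =
      (∑ i ∈ S, a i) ^ 2 - ∑ i ∈ S, a i ^ 2 := by
  induction S using Finset.induction_on with
  | empty => simp [Polynomial.coeff_X_pow]
  | insert b S hb ih =>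
    obtain ⟨h₁, h₂, h₃⟩ := ih
    rw [Finset.prod_insert hb, Finset.sum_insert hb, Finset.sum_insert hb,
      Finset.card_insert_of_notMem hb, mul_left_comm]
    have hz : (Polynomial.X ^ 2 * ∏ i ∈ S, (Polynomial.X - Polynomial.C (a i))).coeff
        (S.card + 3) = 0 := by
      refine Polynomial.coeff_eq_zero_of_natDegree_lt ?_
      refine Polynomial.natDegree_mul_le.trans_lt ?_
      rw [Polynomial.natDegree_finsetProd_X_sub_C_eq_card, Polynomial.natDegree_X_pow]
      omega
    refine ⟨?_, ?_, ?_⟩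
    · rw [show S.card + 1 + 2 = (S.card + 2) + 1 by ring, sub_mul, Polynomial.coeff_sub,
        Polynomial.coeff_X_mul, Polynomial.coeff_C_mul, h₁, hz]
      ring
    · rw [sub_mul, Polynomial.coeff_sub, Polynomial.coeff_X_mul, Polynomial.coeff_C_mul, h₁, h₂]
      ring
    · rw [sub_mul, Polynomial.coeff_sub, Polynomial.coeff_X_mul, Polynomial.coeff_C_mul, h₂,
        mul_sub, h₃]
      ring

/-- Product of the differences between the `r`-th entry of `u` and the other ones. -/
def nodeDiff {n : ℕ} (u : Fin n → ℝ) (r : Fin n) : ℝ :=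
  ∏ j ∈ Finset.univ.erase r, (u r - u j)

lemma nodeDiff_ne_zero {n : ℕ} {u : Fin n → ℝ} (hu : Function.Injective u) (r : Fin n) :
    nodeDiff u r ≠ 0 :=
  Finset.prod_ne_zero_iff.2 fun _ hj => sub_ne_zero.2 (hu.ne (Finset.ne_of_mem_erase hj).symm)

lemma prod_abs_nodeDiff {n : ℕ} (u : Fin n → ℝ) : ∏ r, |nodeDiff u r| = vdm u ^ 2 := by
  simp_rw [nodeDiff, Finset.abs_prod, prod_prod_erase_eq_vdm_sq]

/-- The characteristic polynomial of the bordered diagonal matrix with diagonal `u`, squared border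
entries `w` and corner entry `c`. -/
def borderedPoly {n : ℕ} (u w : Fin n → ℝ) (c : ℝ) : Polynomial ℝ :=
  (Polynomial.X - Polynomial.C c) * rootPoly u - ∑ r, Polynomial.C (w r) * cofactorPoly u r

lemma borderedPoly_eval {n : ℕ} (u w : Fin n → ℝ) (c : ℝ) (r : Fin n) :
    (borderedPoly u w c).eval (u r) = -(w r * nodeDiff u r) := by
  have h : (rootPoly u).eval (u r) = 0 := by
    rw [rootPoly_eval]
    exact Finset.prod_eq_zero (Finset.mem_univ r) (sub_self _)
  simp only [borderedPoly, Polynomial.eval_sub, Polynomial.eval_mul, h, mul_zero,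
    Polynomial.eval_finsetSum, Polynomial.eval_C, zero_sub]
  rw [Finset.sum_eq_single r, cofactorPoly_eval, nodeDiff]
  · intro s _ hs
    rw [cofactorPoly_eval_of_ne u hs.symm, mul_zero]
  · simp

lemma natDegree_sum_cofactorPoly_lt {n : ℕ} (u w : Fin n → ℝ) :
    (∑ r, Polynomial.C (w r) * cofactorPoly u r).degree < n := by
  refine (Polynomial.degree_sum_le _ _).trans_lt ?_
  rw [Finset.sup_lt_iff (by exact_mod_cast WithBot.bot_lt_coe n)]
  intro r _
  refine (Polynomial.degree_mul_le _ _).trans_lt ?_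
  refine (add_le_add_left Polynomial.degree_C_le _).trans_lt ?_
  rw [zero_add]
  rw [Polynomial.degree_eq_natDegree (cofactorPoly_monic u r).ne_zero, cofactorPoly_natDegree]
  have := r.isLt
  exact_mod_cast (by omega : n - 1 < n)

lemma borderedPoly_monic_natDegree {n : ℕ} (u w : Fin n → ℝ) (c : ℝ) :
    (borderedPoly u w c).Monic ∧ (borderedPoly u w c).natDegree = n + 1 := by
  have hm : ((Polynomial.X - Polynomial.C c) * rootPoly u).Monic :=
    (Polynomial.monic_X_sub_C c).mul (rootPoly_monic u)
  have hd : ((Polynomial.X - Polynomial.C c) * rootPoly u).natDegree = n + 1 := by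
    rw [(Polynomial.monic_X_sub_C c).natDegree_mul (rootPoly_monic u), rootPoly_natDegree,
      Polynomial.natDegree_X_sub_C, add_comm]
  have hlt : (∑ r, Polynomial.C (w r) * cofactorPoly u r).degree <
      ((Polynomial.X - Polynomial.C c) * rootPoly u).degree := by
    rw [Polynomial.degree_eq_natDegree hm.ne_zero, hd]
    exact (natDegree_sum_cofactorPoly_lt u w).trans (by exact_mod_cast Nat.lt_succ_self n)
  refine ⟨hm.sub_of_left hlt, ?_⟩
  rw [borderedPoly, Polynomial.natDegree_sub_eq_left_of_natDegree_lt, hd]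
  by_cases h0 : (∑ r, Polynomial.C (w r) * cofactorPoly u r) = 0
  · rw [h0, hd, Polynomial.natDegree_zero]; omega
  · exact Polynomial.natDegree_lt_natDegree h0 hlt

lemma coeff_X_sq_mul_rootPoly {n : ℕ} (u : Fin n → ℝ) :
    (Polynomial.X ^ 2 * rootPoly u).coeff (n + 2) = 1 ∧
    (Polynomial.X ^ 2 * rootPoly u).coeff (n + 1) = -∑ i, u i ∧
    2 * (Polynomial.X ^ 2 * rootPoly u).coeff n = (∑ i, u i) ^ 2 - ∑ i, u i ^ 2 := by
  simpa [rootPoly] using coeff_X_sq_mul_prod u Finset.univ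

lemma coeff_X_sq_mul_borderedPoly {n : ℕ} (u w : Fin n → ℝ) (c : ℝ) :
    (Polynomial.X ^ 2 * borderedPoly u w c).coeff (n + 2) = -(c + ∑ i, u i) ∧
    2 * (Polynomial.X ^ 2 * borderedPoly u w c).coeff (n + 1) =
      (∑ i, u i) ^ 2 - ∑ i, u i ^ 2 + 2 * c * ∑ i, u i - 2 * ∑ i, w i := by
  obtain ⟨h₁, h₂, h₃⟩ := coeff_X_sq_mul_rootPoly u
  have hexp : Polynomial.X ^ 2 * borderedPoly u w c =
      Polynomial.X * (Polynomial.X ^ 2 * rootPoly u) -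
        Polynomial.C c * (Polynomial.X ^ 2 * rootPoly u) -
        Polynomial.X ^ 2 * ∑ r, Polynomial.C (w r) * cofactorPoly u r := by
    rw [borderedPoly]; ring
  have hS := natDegree_sum_cofactorPoly_lt u w
  rw [Polynomial.degree_lt_iff_coeff_zero] at hS
  constructor
  · rw [hexp, Polynomial.coeff_sub, Polynomial.coeff_sub, Polynomial.coeff_X_mul,
      Polynomial.coeff_C_mul, h₁, h₂, Polynomial.coeff_X_pow_mul, hS n le_rfl]
    ring
  · have hw : (Polynomial.X ^ 2 * ∑ r, Polynomial.C (w r) * cofactorPoly u r).coeff (n + 1) =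
        ∑ i, w i := by
      rw [Finset.mul_sum, Polynomial.finsetSum_coeff]
      refine Finset.sum_congr rfl fun r _ => ?_
      have h := (coeff_X_sq_mul_prod u (Finset.univ.erase r)).1
      have hr := r.isLt
      rw [Finset.card_erase_of_mem (Finset.mem_univ r), Finset.card_univ, Fintype.card_fin,
        show n - 1 + 2 = n + 1 by omega] at h
      rw [mul_left_comm, Polynomial.coeff_C_mul, cofactorPoly, h, mul_one]
    rw [hexp, Polynomial.coeff_sub, Polynomial.coeff_sub, Polynomial.coeff_X_mul,
      Polynomial.coeff_C_mul, hw, h₂]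
    linear_combination h₃

/-- Border coordinates of `v` with respect to the diagonal `u`. -/
def borderMap {n : ℕ} (u : Fin n → ℝ) (v : Fin (n + 1) → ℝ) : Fin (n + 1) → ℝ :=
  Fin.snoc (fun r => -(∏ s, (u r - v s)) / nodeDiff u r) (∑ s, v s - ∑ r, u r)

lemma rootPoly_eq_borderedPoly {n : ℕ} {u : Fin n → ℝ} (hu : Function.Injective u)
    (v : Fin (n + 1) → ℝ) :
    rootPoly v = borderedPoly u (fun r => borderMap u v r.castSucc) (borderMap u v (Fin.last n)) := by
  set w := fun r : Fin n => borderMap u v r.castSucc with hw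
  set c := borderMap u v (Fin.last n) with hc
  refine Polynomial.eq_of_degree_sub_lt_of_eval_index_eq (v := u) Finset.univ hu.injOn ?_ ?_
  · rw [Finset.card_univ, Fintype.card_fin, Polynomial.degree_lt_iff_coeff_zero]
    intro k hk
    rw [Polynomial.coeff_sub, sub_eq_zero]
    obtain ⟨hm, hd⟩ := borderedPoly_monic_natDegree u w c
    rcases hk.eq_or_lt with rfl | hk
    · have h₁ := (coeff_X_sq_mul_rootPoly v).2.1
      have h₂ := (coeff_X_sq_mul_borderedPoly u w c).1
      rw [show n + 1 + 1 = n + 2 by ring, Polynomial.coeff_X_pow_mul] at h₁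
      rw [Polynomial.coeff_X_pow_mul] at h₂
      rw [h₁, h₂, hc, borderMap, Fin.snoc_last]
      ring
    rcases (Nat.succ_le_of_lt hk).eq_or_lt with rfl | hk
    · have h₁ := rootPoly_monic v
      rw [Polynomial.Monic, Polynomial.leadingCoeff, rootPoly_natDegree] at h₁
      rw [Polynomial.Monic, Polynomial.leadingCoeff, hd] at hm
      exact h₁.trans hm.symm
    · rw [Polynomial.coeff_eq_zero_of_natDegree_lt (by rw [rootPoly_natDegree]; exact hk),
        Polynomial.coeff_eq_zero_of_natDegree_lt (by rw [hd]; exact hk)]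
  · intro r _
    rw [borderedPoly_eval, rootPoly_eval, hw]
    simp only [borderMap, Fin.snoc_castSucc]
    field_simp [nodeDiff_ne_zero hu r]

lemma borderMap_eq_of_rootPoly_eq {n : ℕ} {u : Fin n → ℝ} (hu : Function.Injective u)
    {v : Fin (n + 1) → ℝ} {w : Fin n → ℝ} {c : ℝ} (h : rootPoly v = borderedPoly u w c) :
    borderMap u v = Fin.snoc w c := by
  funext i
  refine Fin.lastCases ?_ (fun r => ?_) i
  · have h₁ := (coeff_X_sq_mul_rootPoly v).2.1
    rw [h, show n + 1 + 1 = n + 2 by ring, (coeff_X_sq_mul_borderedPoly u w c).1] at h₁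
    simp only [borderMap, Fin.snoc_last]
    linarith
  · have h₁ := congrArg (Polynomial.eval (u r)) h
    rw [borderedPoly_eval, rootPoly_eval] at h₁
    simp only [borderMap, Fin.snoc_castSucc]
    rw [h₁]
    field_simp [nodeDiff_ne_zero hu r]

lemma sum_sq_eq_borderMap {n : ℕ} {u : Fin n → ℝ} (hu : Function.Injective u)
    (v : Fin (n + 1) → ℝ) :
    ∑ s, v s ^ 2 = ∑ r, u r ^ 2 + borderMap u v (Fin.last n) ^ 2 +
      2 * ∑ r : Fin n, borderMap u v r.castSucc := by
  have h₁ := (coeff_X_sq_mul_rootPoly v).2.2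
  have h₂ : borderMap u v (Fin.last n) = ∑ s, v s - ∑ r, u r := by simp [borderMap]
  rw [rootPoly_eq_borderedPoly hu v, (coeff_X_sq_mul_borderedPoly u _ _).2] at h₁
  have h₃ : ∑ s, v s = borderMap u v (Fin.last n) + ∑ r, u r := by rw [h₂]; ring
  rw [h₃] at h₁
  linear_combination h₁

lemma borderMap_pos {n : ℕ} {u : Fin n → ℝ} {v : Fin (n + 1) → ℝ} (h : Interlaces u v)
    (r : Fin n) : 0 < borderMap u v r.castSucc := by
  have h₁ := neg_one_pow_mul_prod_erase_pos h.strictAnti_left r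
  have h₂ : 0 < (-1 : ℝ) ^ (r.1 + 1) * ∏ s, (u r - v s) :=
    neg_one_pow_mul_prod_pos (by have := r.isLt; omega)
      (fun j hj => h.lt_of_le (Fin.le_def.2 (Nat.le_of_lt_succ hj)))
      (fun j hj => h.lt_of_lt (Fin.lt_def.2 hj))
  have h₃ := div_pos h₂ h₁
  rw [pow_succ, mul_assoc, mul_div_mul_left _ _ (by positivity)] at h₃
  simpa [borderMap, nodeDiff] using h₃

lemma exists_interlaces_borderMap {n : ℕ} {u : Fin n → ℝ} (hu : StrictAnti u) {q : Fin (n + 1) → ℝ}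
    (hq : ∀ r : Fin n, 0 < q r.castSucc) : ∃ v, Interlaces u v ∧ borderMap u v = q := by
  set w : Fin n → ℝ := fun r => q r.castSucc
  set c := q (Fin.last n)
  set P := borderedPoly u w c with hP
  obtain ⟨hm, hd⟩ := borderedPoly_monic_natDegree u w c
  obtain ⟨z₀, hz₀, hz₀u⟩ : ∃ z, 0 < P.eval z ∧ ∀ r, u r < z := by
    have ht := Polynomial.tendsto_atTop_of_leadingCoeff_nonneg P
      (Polynomial.natDegree_pos_iff_degree_pos.1 (by rw [hd]; omega)) (by rw [hm.leadingCoeff]; exact zero_le_one)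
    exact ((ht.eventually_gt_atTop 0).and
      (eventually_all.2 fun r => eventually_gt_atTop (u r))).exists
  obtain ⟨z₁, hz₁, hz₁u, hz₁₀⟩ : ∃ z, 0 < (-1) ^ (n + 1) * P.eval z ∧ (∀ r, z < u r) ∧ z < z₀ := by
    have hcomp : (Polynomial.C ((-1 : ℝ) ^ (n + 1)) * P.comp (-Polynomial.X)).leadingCoeff = 1 := by
      rw [Polynomial.leadingCoeff_mul, Polynomial.leadingCoeff_comp (by simp), hm.leadingCoeff, hd]
      simp [← mul_pow]
    have hcd : (Polynomial.C ((-1 : ℝ) ^ (n + 1)) * P.comp (-Polynomial.X)).natDegree = n + 1 := by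
      rw [Polynomial.natDegree_C_mul (by simp), Polynomial.natDegree_comp, hd]
      simp
    have ht := Polynomial.tendsto_atTop_of_leadingCoeff_nonneg _
      (Polynomial.natDegree_pos_iff_degree_pos.1 (by rw [hcd]; omega))
      (by rw [hcomp]; exact zero_le_one)
    obtain ⟨z, ⟨hz, hzu⟩, hzz⟩ := (((ht.eventually_gt_atTop 0).and
      (eventually_all.2 fun r => eventually_gt_atTop (-u r))).and
      (eventually_gt_atTop (-z₀))).exists
    refine ⟨-z, by simpa using hz, fun r => by linarith [hzu r], by linarith⟩
  have hdist := hu.injective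
  set t : Fin (n + 2) → ℝ := Fin.cons z₀ (Fin.snoc u z₁) with ht
  have hta : StrictAnti t := by
    refine Fin.strictAnti_iff_succ_lt.2 fun i => ?_
    refine Fin.cases ?_ (fun j => ?_) i
    · simp only [ht, Fin.cons_succ, Fin.castSucc_zero, Fin.cons_zero]
      have : ∀ k : Fin (n + 1), (Fin.snoc u z₁ : Fin (n + 1) → ℝ) k < z₀ := fun k => by
        refine Fin.lastCases ?_ (fun r => ?_) k
        · simpa using hz₁₀
        · simpa using hz₀u r
      exact this 0
    · simp only [ht, Fin.cons_succ, Fin.castSucc_succ, Fin.snoc_castSucc]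
      have : ∀ k : Fin (n + 1), j.castSucc < k → (Fin.snoc u z₁ : Fin (n + 1) → ℝ) k < u j := by
        intro k
        refine Fin.lastCases ?_ (fun r => ?_) k
        · intro _
          simpa using hz₁u j
        · intro hr
          simpa using hu (Fin.castSucc_lt_castSucc_iff.1 hr)
      exact this _ Fin.castSucc_lt_succ
  obtain ⟨v, hv, hvP⟩ := exists_interlaces_rootPoly hta hm hd (by
    intro k
    refine Fin.cases ?_ (fun k => ?_) k
    · simpa [ht] using hz₀
    · refine Fin.lastCases ?_ (fun r => ?_) k
      · simpa [ht] using hz₁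
      · have h := mul_pos (hq r) (neg_one_pow_mul_prod_erase_pos hu r)
        simp only [ht, Fin.cons_succ, Fin.snoc_castSucc, borderedPoly_eval, Fin.val_succ,
          Fin.val_castSucc, nodeDiff, pow_succ, w]
        linarith)
  refine ⟨v, fun r => ?_, ?_⟩
  · have h₁ := (hv r.castSucc).2
    have h₂ := (hv r.succ).1
    constructor
    · simpa [ht] using h₁
    · simpa [ht] using h₂
  · rw [borderMap_eq_of_rootPoly_eq hdist hvP]
    exact Fin.snoc_init_self q

lemma rpow_two_mul_sub_one {x : ℝ} (hx : 0 < x) (θ : ℝ) :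
    x ^ (2 * θ - 1) = x * (x ^ 2) ^ (θ - 1) := by
  rw [← Real.rpow_natCast, ← Real.rpow_mul hx.le]
  nth_rewrite 2 [← Real.rpow_one x]
  rw [← Real.rpow_add hx]
  congr 1
  push_cast
  ring

lemma lintegral_pi_fin_snoc {n : ℕ} {α : Fin (n + 1) → Type*} [∀ i, MeasurableSpace (α i)]
    (μ : ∀ i, Measure (α i)) [∀ i, SigmaFinite (μ i)]
    {F : (∀ r : Fin n, α r.castSucc) → α (Fin.last n) → ℝ≥0∞}
    (hF : Measurable (Function.uncurry F)) :
    ∫⁻ q, F (fun r => q r.castSucc) (q (Fin.last n)) ∂Measure.pi μ =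
      ∫⁻ w, ∫⁻ c, F w c ∂μ (Fin.last n) ∂Measure.pi (fun r : Fin n => μ r.castSucc) := by
  have hψ : Measurable fun z : (∀ r : Fin n, α r.castSucc) × α (Fin.last n) =>
      (Fin.snoc z.1 z.2 : ∀ i, α i) := by
    refine measurable_pi_iff.2 (Fin.lastCases ?_ fun r => ?_)
    · simpa using measurable_snd
    · simp only [Fin.snoc_castSucc]
      fun_prop
  have hμ : Measure.pi μ = ((Measure.pi fun r : Fin n => μ r.castSucc).prod (μ (Fin.last n))).map
      fun z => (Fin.snoc z.1 z.2 : ∀ i, α i) := by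
    refine Measure.pi_eq fun s hs => ?_
    rw [Measure.map_apply hψ (MeasurableSet.univ_pi hs)]
    have : (fun z : (∀ r : Fin n, α r.castSucc) × α (Fin.last n) =>
        (Fin.snoc z.1 z.2 : ∀ i, α i)) ⁻¹' Set.univ.pi s =
        (Set.univ.pi fun r : Fin n => s r.castSucc) ×ˢ s (Fin.last n) := by
      ext z
      simp [Fin.forall_fin_succ']
    rw [this, Measure.prod_prod, Measure.pi_pi, Fin.prod_univ_castSucc]
  have hF' : Measurable fun q : ∀ i, α i => F (fun r => q r.castSucc) (q (Fin.last n)) :=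
    hF.comp (by fun_prop :
      Measurable fun q : ∀ i, α i => ((fun r : Fin n => q r.castSucc), q (Fin.last n)))
  rw [hμ, lintegral_map hF' hψ]
  simp only [Fin.snoc_castSucc, Fin.snoc_last]
  exact lintegral_prod _ hF.aemeasurable

lemma lintegral_pi_snoc {n : ℕ} (μ : Measure ℝ) [SigmaFinite μ] {F : (Fin n → ℝ) → ℝ → ℝ≥0∞}
    (hF : Measurable (Function.uncurry F)) :
    ∫⁻ q : Fin (n + 1) → ℝ, F (fun r => q r.castSucc) (q (Fin.last n)) ∂Measure.pi (fun _ => μ) =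
      ∫⁻ w, ∫⁻ c, F w c ∂μ ∂Measure.pi (fun _ => μ) :=
  lintegral_pi_fin_snoc (fun _ => μ) hF

lemma lintegral_pi_prod (μ : Measure ℝ) [SigmaFinite μ] {k : ℝ → ℝ≥0∞} (hk : Measurable k) (n : ℕ) :
    ∫⁻ q : Fin n → ℝ, ∏ r, k (q r) ∂Measure.pi (fun _ => μ) = (∫⁻ x, k x ∂μ) ^ n := by
  induction n with
  | zero => simp
  | succ n ih =>
    simp_rw [Fin.prod_univ_castSucc]
    rw [lintegral_pi_snoc μ (F := fun w c => (∏ r, k (w r)) * k c) (by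
      unfold Function.uncurry; fun_prop)]
    simp_rw [lintegral_const_mul _ hk]
    rw [lintegral_mul_const _ (by fun_prop), ih, pow_succ]

/-- The Jacobian matrix of `borderMap u` at `v`. -/
def borderJac {n : ℕ} (u : Fin n → ℝ) (v : Fin (n + 1) → ℝ) :
    Matrix (Fin (n + 1)) (Fin (n + 1)) ℝ :=
  Matrix.of fun r s => (Fin.snoc (fun r => (nodeDiff u r)⁻¹) 1 : Fin (n + 1) → ℝ) r *
    ∏ j ∈ Finset.univ.erase s,
      ((Fin.snoc u 1 : Fin (n + 1) → ℝ) r - (Fin.snoc 1 0 : Fin (n + 1) → ℝ) r * v j)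

lemma hasFDerivAt_neg_prod_sub {N : ℕ} (x : ℝ) (v : Fin N → ℝ) :
    HasFDerivAt (fun v : Fin N → ℝ => -∏ s, (x - v s))
      (∑ s, (∏ j ∈ Finset.univ.erase s, (x - v j)) •
        (ContinuousLinearMap.proj s : (Fin N → ℝ) →L[ℝ] ℝ)) v := by
  have h : ∀ s ∈ (Finset.univ : Finset (Fin N)), HasFDerivAt (fun v : Fin N → ℝ => x - v s)
      (-(ContinuousLinearMap.proj s : (Fin N → ℝ) →L[ℝ] ℝ)) v := fun s _ => by
    exact (hasFDerivAt_apply (𝕜 := ℝ) (F' := fun _ => ℝ) s v).const_sub x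
  refine (HasFDerivAt.finsetProd h).neg.congr_fderiv ?_
  rw [← Finset.sum_neg_distrib]
  exact Finset.sum_congr rfl fun s _ => by rw [smul_neg, neg_neg]

lemma hasFDerivAt_borderMap {n : ℕ} (u : Fin n → ℝ) (v : Fin (n + 1) → ℝ) :
    HasFDerivAt (borderMap u) (Matrix.toLin' (borderJac u v)).toContinuousLinearMap v := by
  rw [hasFDerivAt_pi']
  refine Fin.lastCases ?_ fun r => ?_
  · have h : HasFDerivAt (fun v : Fin (n + 1) → ℝ => ∑ s, v s - ∑ r, u r)
        (∑ s, (ContinuousLinearMap.proj s : (Fin (n + 1) → ℝ) →L[ℝ] ℝ)) v :=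
      (HasFDerivAt.fun_sum fun s _ => hasFDerivAt_apply s v).sub_const _
    simp only [borderMap, Fin.snoc_last]
    refine h.congr_fderiv ?_
    ext x
    simp [borderJac, Matrix.mulVec, dotProduct]
  · simp only [borderMap, Fin.snoc_castSucc, div_eq_mul_inv]
    refine ((hasFDerivAt_neg_prod_sub (u r) v).mul_const (nodeDiff u r)⁻¹).congr_fderiv ?_
    ext x
    simp [borderJac, Matrix.mulVec, dotProduct, Finset.mul_sum, mul_assoc]

lemma abs_det_borderJac {n : ℕ} {u : Fin n → ℝ} {v : Fin (n + 1) → ℝ} (hu : Function.Injective u)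
    (hv : Function.Injective v) : |(borderJac u v).det| = vdm v / vdm u := by
  have hpos := vdm_pos hu
  have h := abs_det_cofactor (a := (Fin.snoc u 1 : Fin (n + 1) → ℝ)) (b := Fin.snoc 1 0) hv
    (Fin.lastCases (by simp) fun r => by simp)
  rw [abs_det_projVandermonde_snoc] at h
  have h' := Matrix.det_mul_column (Fin.snoc (fun r => (nodeDiff u r)⁻¹) 1 : Fin (n + 1) → ℝ)
    (Matrix.of fun r s => ∏ j ∈ Finset.univ.erase s,
      ((Fin.snoc u 1 : Fin (n + 1) → ℝ) r - (Fin.snoc 1 0 : Fin (n + 1) → ℝ) r * v j))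
  simp only [Matrix.of_apply] at h'
  rw [borderJac, h', abs_mul, h, Finset.abs_prod, Fin.prod_univ_castSucc]
  simp only [Fin.snoc_castSucc, Fin.snoc_last, abs_inv, Finset.prod_inv_distrib,
    prod_abs_nodeDiff, abs_one]
  field_simp

lemma measurableSet_interlaces {n : ℕ} :
    MeasurableSet {p : (Fin n → ℝ) × (Fin (n + 1) → ℝ) | Interlaces p.1 p.2} := by
  simp only [Interlaces, Set.ofPred_forall, Set.ofPred_and]
  exact MeasurableSet.iInter fun i =>
    (measurableSet_lt (f := fun p : (Fin n → ℝ) × (Fin (n + 1) → ℝ) => p.1 i)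
      (g := fun p => p.2 i.castSucc) (by fun_prop) (by fun_prop)).inter
    (measurableSet_lt (f := fun p : (Fin n → ℝ) × (Fin (n + 1) → ℝ) => p.2 i.succ)
      (g := fun p => p.1 i) (by fun_prop) (by fun_prop))

lemma measurableSet_interlaces_right {n : ℕ} (u : Fin n → ℝ) :
    MeasurableSet {v : Fin (n + 1) → ℝ | Interlaces u v} :=
  measurable_prodMk_left (x := u) measurableSet_interlaces

lemma measurableSet_interlaces_left {n : ℕ} (v : Fin (n + 1) → ℝ) :
    MeasurableSet {u : Fin n → ℝ | Interlaces u v} :=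
  measurable_prodMk_right (y := v) measurableSet_interlaces

lemma prod_borderMap {n : ℕ} {u : Fin n → ℝ} {v : Fin (n + 1) → ℝ} (h : Interlaces u v) :
    ∏ r : Fin n, borderMap u v r.castSucc = (∏ s, ∏ r, |v s - u r|) / vdm u ^ 2 := by
  have h₁ : ∀ r : Fin n, borderMap u v r.castSucc = (∏ s, |v s - u r|) / |nodeDiff u r| := by
    intro r
    rw [← abs_of_pos (borderMap_pos h r)]
    simp only [borderMap, Fin.snoc_castSucc, abs_div, abs_neg, Finset.abs_prod]
    simp_rw [abs_sub_comm]
  simp_rw [h₁]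
  rw [Finset.prod_div_distrib, prod_abs_nodeDiff, Finset.prod_comm]

/-- Integrating out the top level of a pair of interlacing levels of the Gaussian beta corners
process. -/
lemma lintegral_interlaces_right {θ : ℝ} (hθ : 0 < θ) {n : ℕ} {u : Fin n → ℝ} (hu : StrictAnti u)
    {f : ℝ → ℝ≥0∞} (hf : Measurable f) :
    ∫⁻ v in {v : Fin (n + 1) → ℝ | Interlaces u v}, f (∑ s, v s - ∑ r, u r) *
        ENNReal.ofReal (vdm v * (∏ s, ∏ r, |v s - u r| ^ (θ - 1)) *
          Real.exp (-(θ / 2) * ∑ s, v s ^ 2)) =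
      ENNReal.ofReal ((Real.Gamma θ / θ ^ θ) ^ n * √(2 * Real.pi * θ⁻¹) *
          (vdm u ^ (2 * θ - 1) * Real.exp (-(θ / 2) * ∑ r, u r ^ 2))) *
        ∫⁻ c, f c ∂ProbabilityTheory.gaussianReal 0 (Real.toNNReal θ⁻¹) := by
  have hv0 : Real.toNNReal θ⁻¹ ≠ 0 := by simpa using hθ
  have hΓ := Real.Gamma_pos_of_pos hθ
  set S : Set (Fin (n + 1) → ℝ) := {v | Interlaces u v} with hS
  set g : (Fin (n + 1) → ℝ) → ℝ≥0∞ := fun q =>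
    (∏ r : Fin n, ProbabilityTheory.gammaPDF θ θ (q r.castSucc)) *
      (ProbabilityTheory.gaussianPDF 0 (Real.toNNReal θ⁻¹) (q (Fin.last n)) * f (q (Fin.last n)))
    with hg
  have hcv := lintegral_image_eq_lintegral_abs_det_fderiv_mul volume
    (measurableSet_interlaces_right u)
    (fun v _ => (hasFDerivAt_borderMap u v).hasFDerivWithinAt)
    (fun v (hv : Interlaces u v) w (hw : Interlaces u w) hvw =>
      rootPoly_injOn hv.strictAnti_right hw.strictAnti_right (by
        rw [rootPoly_eq_borderedPoly hu.injective v, rootPoly_eq_borderedPoly hu.injective w, hvw])) g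
  have himg : borderMap u '' S = {q | ∀ r : Fin n, 0 < q r.castSucc} := by
    ext q
    constructor
    · rintro ⟨v, hv, rfl⟩ r
      exact borderMap_pos hv r
    · exact fun hq => exists_interlaces_borderMap hu hq
  have hgm : Measurable fun x => ProbabilityTheory.gammaPDF θ θ x :=
    (ProbabilityTheory.measurable_gammaPDFReal θ θ).ennreal_ofReal
  have hgauss := ProbabilityTheory.measurable_gaussianPDF 0 (Real.toNNReal θ⁻¹)
  have hleft : ∫⁻ q in borderMap u '' S, g q =
      ∫⁻ c, f c ∂ProbabilityTheory.gaussianReal 0 (Real.toNNReal θ⁻¹) := by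
    have h0 : ∫⁻ q in borderMap u '' S, g q = ∫⁻ q, g q := by
      have hne : ∀ᵐ q : Fin (n + 1) → ℝ, ∀ r : Fin n, q r.castSucc ≠ 0 :=
        ae_all_iff.2 fun r => Measure.ae_eval_ne (μ := fun _ => volume) r.castSucc 0
      have hae : ({q | ∀ r : Fin n, 0 < q r.castSucc} : Set (Fin (n + 1) → ℝ)) =ᵐ[volume]
          {q | ∀ r : Fin n, 0 ≤ q r.castSucc} := by
        filter_upwards [hne] with q hq
        exact propext ⟨fun h r => (h r).le, fun h r => lt_of_le_of_ne (h r) (hq r).symm⟩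
      rw [himg, setLIntegral_congr hae]
      refine setLIntegral_eq_of_support_subset fun q hq => ?_
      by_contra hneg
      obtain ⟨r, hr⟩ : ∃ r : Fin n, q r.castSucc < 0 := by simpa using hneg
      exact hq (mul_eq_zero_of_left (Finset.prod_eq_zero (Finset.mem_univ r)
        (ProbabilityTheory.gammaPDF_of_neg hr)) _)
    rw [h0, volume_pi, hg, lintegral_pi_snoc volume (F := fun w c =>
      (∏ r : Fin n, ProbabilityTheory.gammaPDF θ θ (w r)) *
      (ProbabilityTheory.gaussianPDF 0 (Real.toNNReal θ⁻¹) c * f c)) (by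
        unfold Function.uncurry; fun_prop)]
    have hmul : Measurable fun c => ProbabilityTheory.gaussianPDF 0 (Real.toNNReal θ⁻¹) c * f c :=
      hgauss.mul hf
    simp_rw [lintegral_const_mul _ hmul]
    rw [lintegral_mul_const _ (by fun_prop), lintegral_pi_prod _ hgm,
      ProbabilityTheory.lintegral_gammaPDF_eq_one hθ hθ, one_pow, one_mul,
      ProbabilityTheory.gaussianReal_of_var_ne_zero _ hv0,
      lintegral_withDensity_eq_lintegral_mul _ hgauss hf]
    rfl
  rw [← hleft, hcv, ← lintegral_const_mul' _ _ ENNReal.ofReal_ne_top]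
  refine setLIntegral_congr_fun (measurableSet_interlaces_right u) fun v hv => ?_
  have hv : Interlaces u v := hv
  have hdet : |((Matrix.toLin' (borderJac u v)).toContinuousLinearMap).det| = vdm v / vdm u := by
    rw [← abs_det_borderJac hu.injective hv.strictAnti_right.injective]
    simp [ContinuousLinearMap.det]
  have hVu := vdm_pos hu.injective
  have hlast : borderMap u v (Fin.last n) = ∑ s, v s - ∑ r, u r := by simp [borderMap]
  have hgam : ∀ r : Fin n, ProbabilityTheory.gammaPDF θ θ (borderMap u v r.castSucc) =
      ENNReal.ofReal (θ ^ θ / Real.Gamma θ * (borderMap u v r.castSucc ^ (θ - 1) *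
        Real.exp (-(θ * borderMap u v r.castSucc)))) := fun r => by
    rw [ProbabilityTheory.gammaPDF_of_nonneg (borderMap_pos hv r).le, mul_assoc]
  simp only [hdet, hg, hgam, ← hlast]
  rw [← ENNReal.ofReal_prod_of_nonneg fun r _ => by
    have := borderMap_pos hv r
    positivity]
  rw [ProbabilityTheory.gaussianPDF, ← mul_assoc, ← mul_assoc, ← mul_assoc, mul_comm (f _),
    ← ENNReal.ofReal_mul (by positivity), ← ENNReal.ofReal_mul (by have := vdm_nonneg v; positivity),
    ← ENNReal.ofReal_mul (by
      have := vdm_nonneg v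
      have := fun r => (borderMap_pos hv r).le
      exact mul_nonneg (by positivity) (Finset.prod_nonneg fun r _ => by have := this r; positivity))]
  congr 2
  rw [Finset.prod_mul_distrib, Finset.prod_mul_distrib, Finset.prod_const, Finset.card_univ,
    Fintype.card_fin, Real.finsetProd_rpow _ _ fun r _ => (borderMap_pos hv r).le,
    prod_borderMap hv, ← Real.exp_sum, ProbabilityTheory.gaussianPDFReal,
    sum_sq_eq_borderMap hu.injective v]
  rw [Real.coe_toNNReal _ (inv_nonneg.2 hθ.le),
    Real.div_rpow (Finset.prod_nonneg fun s _ => Finset.prod_nonneg fun r _ => abs_nonneg _)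
      (by positivity), ← Real.finsetProd_rpow _ _ fun s _ => Finset.prod_nonneg fun r _ =>
      abs_nonneg _]
  simp_rw [← Real.finsetProd_rpow _ _ fun r _ => abs_nonneg _]
  have hexp : Real.exp (-(θ / 2) * (∑ r, u r ^ 2 + borderMap u v (Fin.last n) ^ 2 +
        2 * ∑ r : Fin n, borderMap u v r.castSucc)) =
      Real.exp (-(θ / 2) * ∑ r, u r ^ 2) * Real.exp (∑ r : Fin n, -(θ * borderMap u v r.castSucc)) *
        Real.exp (-(borderMap u v (Fin.last n) - 0) ^ 2 / (2 * θ⁻¹)) := by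
    rw [← Real.exp_add, ← Real.exp_add, Finset.sum_neg_distrib, ← Finset.mul_sum]
    congr 1
    field_simp
    ring
  rw [rpow_two_mul_sub_one hVu, hexp]
  have hconst : (Real.Gamma θ / θ ^ θ) ^ n * (θ ^ θ / Real.Gamma θ) ^ n = 1 := by
    rw [← mul_pow, div_mul_div_cancel₀' hΓ.ne', div_self (by positivity), one_pow]
  field_simp
  rw [mul_assoc, hconst, mul_one]

lemma setLIntegral_Ioo_rpow_mul_rpow {α β T : ℝ} (hα : 0 < α) (hβ : 0 < β) (hT : 0 < T) :
    ∫⁻ x in Set.Ioo 0 T, ENNReal.ofReal (x ^ (α - 1) * (T - x) ^ (β - 1)) =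
      ENNReal.ofReal (T ^ (α + β - 1) * ProbabilityTheory.beta α β) := by
  have hB := ProbabilityTheory.beta_pos hα hβ
  have himg : (fun x => T * x) '' Set.Ioo 0 1 = Set.Ioo 0 T := by
    rw [Set.image_mul_left_Ioo hT, mul_zero, mul_one]
  rw [← himg, lintegral_image_eq_lintegral_abs_deriv_mul (f' := fun _ => T) measurableSet_Ioo
    (fun x _ => by simpa using ((hasDerivAt_id x).const_mul T).hasDerivWithinAt)
    (fun x _ y _ h => mul_left_cancel₀ hT.ne' h)]
  rw [← mul_one (ENNReal.ofReal (T ^ (α + β - 1) * ProbabilityTheory.beta α β)),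
    ← ProbabilityTheory.lintegral_betaPDF_eq_one hα hβ, ProbabilityTheory.lintegral_betaPDF,
    ← lintegral_const_mul' _ _ ENNReal.ofReal_ne_top]
  refine setLIntegral_congr_fun measurableSet_Ioo fun x hx => ?_
  have hx0 : 0 < x := hx.1
  have hx1 : 0 < 1 - x := sub_pos.2 hx.2
  rw [← ENNReal.ofReal_mul (by positivity), ← ENNReal.ofReal_mul (by positivity), abs_of_pos hT,
    show T - T * x = T * (1 - x) by ring, Real.mul_rpow hT.le hx0.le, Real.mul_rpow hT.le hx1.le,
    show α + β - 1 = 1 + (α - 1) + (β - 1) by ring, Real.rpow_add hT, Real.rpow_add hT,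
    Real.rpow_one]
  field_simp

/-- The open standard simplex, in coordinates that drop the last barycentric coordinate. -/
def openSimplex (n : ℕ) : Set (Fin n → ℝ) :=
  {p | (∀ r, 0 < p r) ∧ ∑ r, p r < 1}

lemma measurableSet_openSimplex (n : ℕ) : MeasurableSet (openSimplex n) := by
  simp only [openSimplex, Set.ofPred_and, Set.ofPred_forall]
  exact (MeasurableSet.iInter fun r => measurableSet_lt measurable_const (measurable_pi_apply r)).inter
    (measurableSet_lt (by fun_prop) measurable_const)

/-- The Dirichlet integral. -/
lemma lintegral_openSimplex {θ : ℝ} (hθ : 0 < θ) (n : ℕ) {β : ℝ} (hβ : 0 < β) :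
    ∫⁻ p in openSimplex n, ENNReal.ofReal ((∏ r, p r ^ (θ - 1)) * (1 - ∑ r, p r) ^ (β - 1)) =
      ENNReal.ofReal (Real.Gamma θ ^ n * Real.Gamma β / Real.Gamma (n * θ + β)) := by
  induction n generalizing β with
  | zero =>
    have h := (Real.Gamma_pos_of_pos hβ).ne'
    have : openSimplex 0 = Set.univ := by ext p; simp [openSimplex]
    simp [this, h, volume_pi]
  | succ n ih =>
    have hΓ := Real.Gamma_pos_of_pos hθ
    set F : (Fin n → ℝ) → ℝ → ℝ≥0∞ := fun w c =>
      (openSimplex n).indicator 1 w * (Set.Ioo 0 (1 - ∑ r, w r)).indicator (fun c =>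
        ENNReal.ofReal ((∏ r, w r ^ (θ - 1)) * (c ^ (θ - 1) * (1 - ∑ r, w r - c) ^ (β - 1)))) c with hF
    have hFm : Measurable (Function.uncurry F) := by
      refine ((measurable_one.indicator (measurableSet_openSimplex n)).comp measurable_fst).mul ?_
      have hs : MeasurableSet {z : (Fin n → ℝ) × ℝ | 0 < z.2 ∧ z.2 < 1 - ∑ r, z.1 r} :=
        (measurableSet_lt measurable_const measurable_snd).inter
          (measurableSet_lt measurable_snd (by fun_prop))
      exact Measurable.indicator (f := fun z : (Fin n → ℝ) × ℝ => ENNReal.ofReal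
        ((∏ r, z.1 r ^ (θ - 1)) * (z.2 ^ (θ - 1) * (1 - ∑ r, z.1 r - z.2) ^ (β - 1))))
        (by fun_prop) hs
    rw [← lintegral_indicator (measurableSet_openSimplex _)]
    have h₁ : ∀ q : Fin (n + 1) → ℝ, (openSimplex (n + 1)).indicator (fun p =>
        ENNReal.ofReal ((∏ r, p r ^ (θ - 1)) * (1 - ∑ r, p r) ^ (β - 1))) q =
        F (fun r => q r.castSucc) (q (Fin.last n)) := by
      intro q
      have hiff : q ∈ openSimplex (n + 1) ↔ (fun r : Fin n => q r.castSucc) ∈ openSimplex n ∧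
          q (Fin.last n) ∈ Set.Ioo 0 (1 - ∑ r : Fin n, q r.castSucc) := by
        simp only [openSimplex, Set.mem_ofPred_eq, Fin.forall_fin_succ', Fin.sum_univ_castSucc,
          Set.mem_Ioo]
        constructor
        · rintro ⟨⟨h, h'⟩, h''⟩
          exact ⟨⟨h, by linarith⟩, h', by linarith⟩
        · rintro ⟨⟨h, -⟩, h', h''⟩
          exact ⟨⟨h, h'⟩, by linarith⟩
      by_cases hq : q ∈ openSimplex (n + 1)
      · obtain ⟨ha, hb⟩ := hiff.1 hq
        simp only [hF, Set.indicator_of_mem hq, Set.indicator_of_mem ha, Set.indicator_of_mem hb,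
          Pi.one_apply, one_mul, Fin.prod_univ_castSucc, Fin.sum_univ_castSucc]
        rw [mul_assoc, sub_add_eq_sub_sub]
      · rw [Set.indicator_of_notMem hq]
        rw [hiff, not_and_or] at hq
        rcases hq with hq | hq <;> simp [hF, Set.indicator_of_notMem hq]
    simp_rw [h₁]
    rw [volume_pi, lintegral_pi_snoc volume hFm]
    have h₂ : ∀ w, ∫⁻ c, F w c = (openSimplex n).indicator (fun w =>
        ENNReal.ofReal (ProbabilityTheory.beta θ β) *
          ENNReal.ofReal ((∏ r, w r ^ (θ - 1)) * (1 - ∑ r, w r) ^ (θ + β - 1))) w := by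
      intro w
      by_cases hw : w ∈ openSimplex n
      · have hp : 0 ≤ ∏ r, w r ^ (θ - 1) :=
          Finset.prod_nonneg fun r _ => Real.rpow_nonneg (hw.1 r).le _
        simp only [hF, Set.indicator_of_mem hw, Pi.one_apply, one_mul, ENNReal.ofReal_mul hp]
        rw [lintegral_indicator measurableSet_Ioo, lintegral_const_mul' _ _ ENNReal.ofReal_ne_top,
          setLIntegral_Ioo_rpow_mul_rpow hθ hβ (sub_pos.2 hw.2), mul_comm (_ ^ _),
          ENNReal.ofReal_mul (ProbabilityTheory.beta_pos hθ hβ).le]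
        ring
      · simp [hF, Set.indicator_of_notMem hw]
    simp_rw [h₂]
    rw [lintegral_indicator (measurableSet_openSimplex _),
      lintegral_const_mul' _ _ ENNReal.ofReal_ne_top, ← volume_pi, ih (add_pos hθ hβ),
      ← ENNReal.ofReal_mul (ProbabilityTheory.beta_pos hθ hβ).le, ProbabilityTheory.beta]
    have := Real.Gamma_pos_of_pos (add_pos hθ hβ)
    congr 1
    rw [show ((n + 1 : ℕ) : ℝ) * θ + β = n * θ + (θ + β) by push_cast; ring]
    field_simp
    ring

/-- Barycentric coordinates of `u` with respect to the nodes `v`. -/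
def baryCoord {n : ℕ} (v : Fin (n + 1) → ℝ) (u : Fin n → ℝ) (s : Fin (n + 1)) : ℝ :=
  (∏ r, (v s - u r)) / nodeDiff v s

lemma sum_cofactorPoly_eval {n : ℕ} (v p : Fin n → ℝ) (r : Fin n) :
    (∑ s, Polynomial.C (p s) * cofactorPoly v s).eval (v r) = p r * nodeDiff v r := by
  rw [Polynomial.eval_finsetSum, Finset.sum_eq_single r]
  · simp [cofactorPoly_eval, nodeDiff]
  · intro s _ hs
    simp [cofactorPoly_eval_of_ne v hs.symm]
  · simp

lemma sum_cofactorPoly_coeff {n : ℕ} (v p : Fin (n + 1) → ℝ) :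
    (∑ s, Polynomial.C (p s) * cofactorPoly v s).coeff n = ∑ s, p s := by
  rw [Polynomial.finsetSum_coeff]
  refine Finset.sum_congr rfl fun s _ => ?_
  have h := (cofactorPoly_monic v s).coeff_natDegree
  rw [cofactorPoly_natDegree, Nat.add_sub_cancel] at h
  rw [Polynomial.coeff_C_mul, h, mul_one]

lemma rootPoly_eq_sum_baryCoord {n : ℕ} {v : Fin (n + 1) → ℝ} (hv : Function.Injective v)
    (u : Fin n → ℝ) :
    rootPoly u = ∑ s, Polynomial.C (baryCoord v u s) * cofactorPoly v s := by
  refine Polynomial.eq_of_degrees_lt_of_eval_index_eq (v := v) Finset.univ hv.injOn ?_ ?_ ?_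
  · rw [Finset.card_univ, Fintype.card_fin]
    refine (Polynomial.degree_le_natDegree).trans_lt ?_
    rw [rootPoly_natDegree]
    exact_mod_cast Nat.lt_succ_self n
  · rw [Finset.card_univ, Fintype.card_fin]
    exact natDegree_sum_cofactorPoly_lt _ _
  · intro s _
    rw [sum_cofactorPoly_eval, rootPoly_eval, baryCoord, div_mul_cancel₀ _ (nodeDiff_ne_zero hv s)]

lemma sum_baryCoord {n : ℕ} {v : Fin (n + 1) → ℝ} (hv : Function.Injective v) (u : Fin n → ℝ) :
    ∑ s, baryCoord v u s = 1 := by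
  have h := (rootPoly_monic u).coeff_natDegree
  rwa [rootPoly_natDegree, rootPoly_eq_sum_baryCoord hv u, sum_cofactorPoly_coeff] at h

lemma baryCoord_pos {n : ℕ} {v : Fin (n + 1) → ℝ} {u : Fin n → ℝ} (h : Interlaces u v)
    (s : Fin (n + 1)) : 0 < baryCoord v u s := by
  have h₁ := neg_one_pow_mul_prod_erase_pos h.strictAnti_right s
  have h₂ : 0 < (-1 : ℝ) ^ s.1 * ∏ r, (v s - u r) :=
    neg_one_pow_mul_prod_pos (Nat.le_of_lt_succ s.isLt)
      (fun j hj => h.lt_of_lt (Fin.lt_def.2 (by simpa using hj)))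
      (fun j hj => h.lt_of_le (Fin.le_def.2 (by simpa using hj)))
  have h₃ := div_pos h₂ h₁
  rw [mul_div_mul_left _ _ (by positivity)] at h₃
  exact h₃

lemma prod_baryCoord {n : ℕ} {v : Fin (n + 1) → ℝ} {u : Fin n → ℝ} (h : Interlaces u v) :
    ∏ s, baryCoord v u s = (∏ s, ∏ r, |v s - u r|) / vdm v ^ 2 := by
  have h₁ : ∀ s, baryCoord v u s = (∏ r, |v s - u r|) / |nodeDiff v s| := by
    intro s
    rw [← abs_of_pos (baryCoord_pos h s), baryCoord, abs_div, Finset.abs_prod]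
  simp_rw [h₁]
  rw [Finset.prod_div_distrib, prod_abs_nodeDiff]

lemma exists_interlaces_baryCoord {n : ℕ} {v : Fin (n + 1) → ℝ} (hv : StrictAnti v)
    {p : Fin (n + 1) → ℝ} (hp : ∀ s, 0 < p s) (hsum : ∑ s, p s = 1) :
    ∃ u, Interlaces u v ∧ baryCoord v u = p := by
  set P := ∑ s, Polynomial.C (p s) * cofactorPoly v s with hP
  have hdeg : P.degree < (n + 1 : ℕ) := natDegree_sum_cofactorPoly_lt _ _
  have hcoeff : P.coeff n = 1 := by rw [hP, sum_cofactorPoly_coeff, hsum]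
  have hle : P.natDegree ≤ n :=
    Polynomial.natDegree_le_iff_degree_le.2 (Order.le_of_lt_succ (by exact_mod_cast hdeg))
  have hd : P.natDegree = n :=
    Polynomial.natDegree_eq_of_le_of_coeff_ne_zero hle (by rw [hcoeff]; exact one_ne_zero)
  have hm : P.Monic := Polynomial.monic_of_natDegree_le_of_coeff_eq_one n hle hcoeff
  obtain ⟨u, hu, huP⟩ := exists_interlaces_rootPoly hv hm hd fun k => by
    rw [hP, sum_cofactorPoly_eval]
    have := mul_pos (hp k) (neg_one_pow_mul_prod_erase_pos hv k)
    rw [nodeDiff]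
    linarith
  refine ⟨u, hu, funext fun s => ?_⟩
  rw [baryCoord, ← rootPoly_eval, huP, hP, sum_cofactorPoly_eval,
    mul_div_cancel_right₀ _ (nodeDiff_ne_zero hv.injective s)]

/-- The Jacobian matrix of the first `n` barycentric coordinates. -/
def baryJac {n : ℕ} (v : Fin (n + 1) → ℝ) (u : Fin n → ℝ) : Matrix (Fin n) (Fin n) ℝ :=
  Matrix.of fun s r => -(nodeDiff v s.castSucc)⁻¹ *
    ∏ j ∈ Finset.univ.erase r, (v s.castSucc - 1 * u j)

lemma hasFDerivAt_baryCoord {n : ℕ} (v : Fin (n + 1) → ℝ) (u : Fin n → ℝ) :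
    HasFDerivAt (fun u (s : Fin n) => baryCoord v u s.castSucc)
      (Matrix.toLin' (baryJac v u)).toContinuousLinearMap u := by
  rw [hasFDerivAt_pi']
  intro s
  have h := (hasFDerivAt_neg_prod_sub (v s.castSucc) u).mul_const (-(nodeDiff v s.castSucc)⁻¹)
  simp only [neg_mul_neg] at h
  simp only [baryCoord, div_eq_mul_inv]
  refine h.congr_fderiv ?_
  ext x
  simp [baryJac, Matrix.mulVec, dotProduct, Finset.mul_sum, mul_assoc]

lemma vdm_succ {n : ℕ} (v : Fin (n + 1) → ℝ) :
    vdm v = vdm (fun s : Fin n => v s.castSucc) * ∏ s : Fin n, |v s.castSucc - v (Fin.last n)| := by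
  have hlast : ∀ j : Fin n, ¬ Fin.last n < j.castSucc := fun j => (Fin.castSucc_lt_last j).not_gt
  simp only [vdm, Fin.prod_univ_castSucc, Fin.castSucc_lt_castSucc_iff, Fin.castSucc_lt_last,
    if_true, hlast, if_false, lt_irrefl, Finset.prod_const_one, mul_one, Finset.prod_mul_distrib]

lemma prod_abs_nodeDiff_castSucc {n : ℕ} (v : Fin (n + 1) → ℝ) :
    ∏ s : Fin n, |nodeDiff v s.castSucc| = vdm (fun s : Fin n => v s.castSucc) * vdm v := by
  have h : ∀ s : Fin n, nodeDiff v s.castSucc =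
      nodeDiff (fun s : Fin n => v s.castSucc) s * (v s.castSucc - v (Fin.last n)) := by
    intro s
    have hset : (Finset.univ.erase s.castSucc : Finset (Fin (n + 1))) =
        Finset.cons (Fin.last n) ((Finset.univ.erase s).map Fin.castSuccEmb) (by simp) := by
      ext j
      refine Fin.lastCases ?_ (fun j => ?_) j
      · simp [(Fin.castSucc_lt_last s).ne']
      · simp [(Fin.castSucc_lt_last j).ne]
    rw [nodeDiff, hset, Finset.prod_cons, Finset.prod_map, mul_comm]
    rfl
  simp_rw [h, abs_mul]
  rw [Finset.prod_mul_distrib, prod_abs_nodeDiff, vdm_succ v]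
  ring

lemma abs_det_baryJac {n : ℕ} {v : Fin (n + 1) → ℝ} {u : Fin n → ℝ} (hu : Function.Injective u)
    (hv : Function.Injective v) : |(baryJac v u).det| = vdm u / vdm v := by
  have hpos := vdm_pos hv
  have hpos' := vdm_pos (hv.comp (Fin.castSucc_injective n))
  have h := abs_det_cofactor (a := fun s : Fin n => v s.castSucc) (b := 1) hu (by simp)
  rw [← Matrix.vandermonde_eq_projVandermonde, abs_det_vandermonde] at h
  have h' := Matrix.det_mul_column (fun s : Fin n => -(nodeDiff v s.castSucc)⁻¹)
    (Matrix.of fun s r => ∏ j ∈ Finset.univ.erase r, (v s.castSucc - 1 * u j))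
  simp only [Matrix.of_apply] at h'
  simp only [Pi.one_apply] at h
  rw [baryJac, h', abs_mul, h, Finset.abs_prod]
  simp only [abs_neg, abs_inv, Finset.prod_inv_distrib, prod_abs_nodeDiff_castSucc]
  change 0 < vdm fun s : Fin n => v s.castSucc at hpos'
  field_simp

/-- The Dixon–Anderson integral. -/
lemma lintegral_interlaces_left {θ : ℝ} (hθ : 0 < θ) {n : ℕ} {v : Fin (n + 1) → ℝ}
    (hv : StrictAnti v) :
    ∫⁻ u in {u : Fin n → ℝ | Interlaces u v},
        ENNReal.ofReal (vdm u * ∏ s, ∏ r, |v s - u r| ^ (θ - 1)) =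
      ENNReal.ofReal (Real.Gamma θ ^ (n + 1) / Real.Gamma ((n + 1) * θ) * vdm v ^ (2 * θ - 1)) := by
  have hV := vdm_pos hv.injective
  have hlast : ∀ u : Fin n → ℝ, 1 - ∑ s : Fin n, baryCoord v u s.castSucc =
      baryCoord v u (Fin.last n) := by
    intro u
    have := sum_baryCoord hv.injective u
    rw [Fin.sum_univ_castSucc] at this
    linarith
  have hcv := lintegral_image_eq_lintegral_abs_det_fderiv_mul volume
    (measurableSet_interlaces_left v)
    (fun u _ => (hasFDerivAt_baryCoord v u).hasFDerivWithinAt)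
    (fun u (hu : Interlaces u v) w (hw : Interlaces w v) huw =>
      rootPoly_injOn hu.strictAnti_left hw.strictAnti_left (by
        have : baryCoord v u = baryCoord v w := funext <| Fin.lastCases (by
          rw [← hlast, ← hlast]
          exact congrArg (fun p : Fin n → ℝ => 1 - ∑ s, p s) huw) fun s => congrFun huw s
        rw [rootPoly_eq_sum_baryCoord hv.injective u, rootPoly_eq_sum_baryCoord hv.injective w,
          this]))
    (fun p => ENNReal.ofReal ((∏ r, p r ^ (θ - 1)) * (1 - ∑ r, p r) ^ (θ - 1)))
  have himg : (fun (u : Fin n → ℝ) (s : Fin n) => baryCoord v u s.castSucc) ''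
      {u | Interlaces u v} = openSimplex n := by
    ext p
    constructor
    · rintro ⟨u, hu, rfl⟩
      refine ⟨fun r => baryCoord_pos hu _, ?_⟩
      have := baryCoord_pos hu (Fin.last n)
      rw [← hlast] at this
      linarith
    · rintro ⟨hp, hp'⟩
      obtain ⟨u, hu, hup⟩ := exists_interlaces_baryCoord hv
        (p := Fin.snoc p (1 - ∑ r, p r)) (Fin.lastCases (by simpa using hp') (by simpa using hp))
        (by simp [Fin.sum_univ_castSucc])
      exact ⟨u, hu, funext fun s => by simp [hup]⟩
  rw [himg, lintegral_openSimplex hθ n hθ] at hcv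
  rw [mul_comm, ENNReal.ofReal_mul (by positivity), pow_succ, add_mul, one_mul, hcv,
    ← lintegral_const_mul' _ _ ENNReal.ofReal_ne_top]
  refine setLIntegral_congr_fun (measurableSet_interlaces_left v) fun u hu => ?_
  have hu : Interlaces u v := hu
  have hdet : |((Matrix.toLin' (baryJac v u)).toContinuousLinearMap).det| = vdm u / vdm v := by
    rw [← abs_det_baryJac hu.strictAnti_left.injective hv.injective]
    simp [ContinuousLinearMap.det]
  have hU := vdm_nonneg u
  simp only [hdet, hlast]
  rw [← ENNReal.ofReal_mul (by positivity), ← ENNReal.ofReal_mul (by positivity),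
    ← Fin.prod_univ_castSucc (f := fun s => baryCoord v u s ^ (θ - 1)),
    Real.finsetProd_rpow _ _ fun s _ => (baryCoord_pos hu s).le, prod_baryCoord hu,
    Real.div_rpow (Finset.prod_nonneg fun s _ => Finset.prod_nonneg fun r _ => abs_nonneg _)
      (by positivity), ← Real.finsetProd_rpow _ _ fun s _ => Finset.prod_nonneg fun r _ =>
      abs_nonneg _]
  simp_rw [← Real.finsetProd_rpow _ _ fun r _ => abs_nonneg _]
  rw [rpow_two_mul_sub_one hV]
  congr 1
  field_simp

/-- The triangular array obtained by removing the top level. -/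
def triInit {n : ℕ} (x : Tri (n + 1)) : Tri n := fun k => x k.castSucc

/-- The top level of a nonempty triangular array. -/
def triLast {n : ℕ} (x : Tri (n + 1)) : Fin (n + 1) → ℝ := x (Fin.last n)

lemma measurable_triInit {n : ℕ} : Measurable (triInit (n := n)) :=
  measurable_pi_lambda _ fun k => measurable_pi_apply (Fin.castSucc k)

lemma measurable_triLast {n : ℕ} : Measurable (triLast (n := n)) :=
  measurable_pi_apply (Fin.last n)

lemma lintegral_tri_succ {n : ℕ} {F : Tri n → (Fin (n + 1) → ℝ) → ℝ≥0∞}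
    (hF : Measurable (Function.uncurry F)) :
    ∫⁻ x : Tri (n + 1), F (triInit x) (triLast x) = ∫⁻ w, ∫⁻ u, F w u :=
  lintegral_pi_fin_snoc (α := fun k : Fin (n + 1) => Fin (k.1 + 1) → ℝ) (fun _ => volume) hF

lemma lvl_eq_lvl_triInit {n : ℕ} (v : Fin (n + 2) → ℝ) (x : Tri (n + 1)) {k : ℕ} (hk : k < n + 1)
    (hk' : k < n + 2) :
    lvl v x k hk' = lvl (triLast x) (triInit x) k hk := by
  unfold lvl
  rw [dif_pos (show k < n + 2 - 1 from hk)]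
  by_cases h : k < n
  · rw [dif_pos (show k < n + 1 - 1 from h)]
    rfl
  · obtain rfl : k = n := by omega
    rw [dif_neg (show ¬ k < k + 1 - 1 from h)]
    rfl

lemma lvl_top {n : ℕ} (v : Fin (n + 1) → ℝ) (x : Tri n) (hk : n < n + 1) :
    lvl v x n hk = v := by
  unfold lvl
  rw [dif_neg (show ¬ n < n + 1 - 1 from lt_irrefl n)]

lemma mem_obpDomain_succ {n : ℕ} (v : Fin (n + 2) → ℝ) (x : Tri (n + 1)) :
    x ∈ obpDomain v ↔ triInit x ∈ obpDomain (triLast x) ∧ Interlaces (triLast x) v := by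
  refine (Fin.forall_fin_succ' (n := n) (P := fun k => Interlaces (x k)
    (lvl v x (k.1 + 1) (by have := k.isLt; omega)))).trans ?_
  refine and_congr (forall_congr' fun k => ?_) ?_
  · have := lvl_eq_lvl_triInit v x (k := k.1 + 1) (by have := k.isLt; omega)
      (by have := k.isLt; omega)
    exact iff_of_eq (congrArg (Interlaces _) this)
  · exact iff_of_eq (congrArg (Interlaces _) (lvl_top v x _))

/-- The weight of a pair of consecutive levels `u ≺ v` in the orbital beta process. -/
def pairWt (θ : ℝ) {n : ℕ} (v : Fin (n + 1) → ℝ) (u : Fin n → ℝ) : ℝ :=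
  vdm u ^ (2 - 2 * θ) * ∏ s, ∏ r, |v s - u r| ^ (θ - 1)

lemma obpWt_succ (θ : ℝ) {n : ℕ} (v : Fin (n + 2) → ℝ) (x : Tri (n + 1)) :
    obpWt θ v x = obpWt θ (triLast x) (triInit x) * pairWt θ v (triLast x) := by
  refine (Fin.prod_univ_castSucc (n := n) _).trans ?_
  refine congrArg₂ (· * ·) (Finset.prod_congr rfl fun k _ => ?_) ?_
  · have := lvl_eq_lvl_triInit v x (k := k.1 + 1) (by have := k.isLt; omega)
      (by have := k.isLt; omega)
    refine congrArg₂ (· * ·) rfl ?_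
    refine Finset.prod_congr rfl fun s _ => Finset.prod_congr rfl fun r _ => ?_
    exact congrArg (fun t => |t - x k.castSucc r| ^ (θ - 1)) (congrFun this s)
  · refine congrArg₂ (· * ·) (prod_rpow_eq_vdm_rpow _ _) ?_
    refine Finset.prod_congr rfl fun s _ => Finset.prod_congr rfl fun r _ => ?_
    exact congrArg (fun t => |t - x (Fin.last n) r| ^ (θ - 1)) (congrFun (lvl_top v x _) s)

/-- The increments `|a⁽ᵏ⁾| - |a⁽ᵏ⁻¹⁾|` of the sums of the levels. -/
def triIncr {n : ℕ} (v : Fin (n + 1) → ℝ) (x : Tri n) : Fin (n + 1) → ℝ :=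
  fun k => sumLvl v x (k.1 + 1) - sumLvl v x k.1

lemma sumLvl_eq_sumLvl_triInit {n : ℕ} (v : Fin (n + 2) → ℝ) (x : Tri (n + 1)) {k : ℕ}
    (hk : k ≤ n + 1) : sumLvl v x k = sumLvl (triLast x) (triInit x) k := by
  unfold sumLvl
  rcases k with _ | k
  · simp
  rw [if_neg (Nat.succ_ne_zero k), if_neg (Nat.succ_ne_zero k),
    dif_pos (show k + 1 - 1 < n + 2 - 1 by omega)]
  by_cases h : k < n
  · rw [dif_pos (show k + 1 - 1 < n + 1 - 1 from h)]
    rfl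
  · obtain rfl : k = n := by omega
    rw [dif_neg (show ¬ k + 1 - 1 < k + 1 - 1 from h)]
    rfl

lemma sumLvl_top {n : ℕ} (v : Fin (n + 1) → ℝ) (x : Tri n) : sumLvl v x (n + 1) = ∑ i, v i := by
  unfold sumLvl
  rw [if_neg (Nat.succ_ne_zero n), dif_neg (show ¬ n + 1 - 1 < n + 1 - 1 from lt_irrefl n)]

lemma triIncr_succ {n : ℕ} (v : Fin (n + 2) → ℝ) (x : Tri (n + 1)) :
    triIncr v x = (Fin.snoc (triIncr (triLast x) (triInit x)) (∑ i, v i - ∑ i, triLast x i) :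
      Fin (n + 2) → ℝ) := by
  funext k
  refine Fin.lastCases ?_ (fun k => ?_) k
  · rw [Fin.snoc_last, triIncr, Fin.val_last, sumLvl_top v x,
      sumLvl_eq_sumLvl_triInit v x le_rfl, sumLvl_top]
  · have := k.isLt
    rw [Fin.snoc_castSucc, triIncr, triIncr, Fin.val_castSucc,
      sumLvl_eq_sumLvl_triInit v x (by omega), sumLvl_eq_sumLvl_triInit v x (by omega)]

lemma triIncr_zero (v : Fin 1 → ℝ) (x : Tri 0) (k : Fin 1) : triIncr v x k = v 0 := by
  obtain rfl : k = 0 := Subsingleton.elim _ _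
  simp [triIncr, sumLvl]

lemma measurable_finSnoc {n : ℕ} : Measurable fun z : (Fin n → ℝ) × ℝ =>
    (Fin.snoc z.1 z.2 : Fin (n + 1) → ℝ) := by
  refine measurable_pi_iff.2 (Fin.lastCases ?_ fun r => ?_)
  · simpa using measurable_snd
  · simp only [Fin.snoc_castSucc]
    fun_prop

lemma measurable_triIncr (n : ℕ) :
    Measurable fun z : (Fin (n + 1) → ℝ) × Tri n => triIncr z.1 z.2 := by
  induction n with
  | zero =>
    refine measurable_pi_iff.2 fun k => ?_
    simp_rw [triIncr_zero]
    fun_prop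
  | succ n ih =>
    simp_rw [triIncr_succ]
    have hL : Measurable fun z : (Fin (n + 2) → ℝ) × Tri (n + 1) => triLast z.2 :=
      measurable_triLast.comp measurable_snd
    have hI : Measurable fun z : (Fin (n + 2) → ℝ) × Tri (n + 1) => triInit z.2 :=
      measurable_triInit.comp measurable_snd
    exact measurable_finSnoc.comp ((ih.comp (hL.prodMk hI)).prodMk (by fun_prop))

/-- The density of a pair of consecutive levels, extended by zero off the interlacing set. -/
def pairDens (θ : ℝ) {n : ℕ} (v : Fin (n + 1) → ℝ) (u : Fin n → ℝ) : ℝ≥0∞ :=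
  {u | Interlaces u v}.indicator (fun u => ENNReal.ofReal (pairWt θ v u)) u

/-- The density of the orbital beta process, extended by zero off the interlacing scheme. -/
def obpDens (θ : ℝ) {n : ℕ} (v : Fin (n + 1) → ℝ) (x : Tri n) : ℝ≥0∞ :=
  (obpDomain v).indicator (fun x => ENNReal.ofReal (obpWt θ v x)) x

lemma measurable_vdm {n : ℕ} : Measurable (vdm (n := n)) := by
  unfold vdm
  refine Finset.measurable_prod _ fun i _ => Finset.measurable_prod _ fun j _ => ?_
  split_ifs <;> fun_prop

lemma measurable_pairDens (θ : ℝ) (n : ℕ) :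
    Measurable fun z : (Fin (n + 1) → ℝ) × (Fin n → ℝ) => pairDens θ z.1 z.2 := by
  refine Measurable.indicator (f := fun z : (Fin (n + 1) → ℝ) × (Fin n → ℝ) =>
    ENNReal.ofReal (pairWt θ z.1 z.2))
    (s := Prod.swap ⁻¹' {p : (Fin n → ℝ) × (Fin (n + 1) → ℝ) | Interlaces p.1 p.2}) ?_
    (measurable_swap measurableSet_interlaces)
  have h : Measurable fun z : (Fin (n + 1) → ℝ) × (Fin n → ℝ) => vdm z.2 :=
    measurable_vdm.comp measurable_snd
  exact ((h.pow_const (2 - 2 * θ)).mul (by fun_prop)).ennreal_ofReal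

lemma obpWt_nonneg (θ : ℝ) {N : ℕ} (v : Fin N → ℝ) (x : Tri (N - 1)) : 0 ≤ obpWt θ v x := by
  refine Finset.prod_nonneg fun k _ => mul_nonneg ?_ ?_
  · rw [prod_rpow_eq_vdm_rpow]
    exact Real.rpow_nonneg (vdm_nonneg _) _
  · exact Finset.prod_nonneg fun s _ => Finset.prod_nonneg fun r _ =>
      Real.rpow_nonneg (abs_nonneg _) _

lemma obpDens_succ (θ : ℝ) {n : ℕ} (v : Fin (n + 2) → ℝ) (x : Tri (n + 1)) :
    obpDens θ v x = pairDens θ v (triLast x) * obpDens θ (triLast x) (triInit x) := by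
  unfold obpDens pairDens
  by_cases h : x ∈ obpDomain v
  · obtain ⟨h₁, h₂⟩ := (mem_obpDomain_succ v x).1 h
    rw [Set.indicator_of_mem h, Set.indicator_of_mem h₁, Set.indicator_of_mem
      (show triLast x ∈ {u | Interlaces u v} from h₂), obpWt_succ,
      ENNReal.ofReal_mul (obpWt_nonneg _ _ _), mul_comm]
  · rw [Set.indicator_of_notMem h]
    rw [mem_obpDomain_succ, not_and_or] at h
    rcases h with h | h
    · rw [Set.indicator_of_notMem h, mul_zero]
    · rw [Set.indicator_of_notMem (show triLast x ∉ {u | Interlaces u v} from h), zero_mul]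

lemma obpDens_zero (θ : ℝ) (v : Fin 1 → ℝ) (x : Tri 0) : obpDens θ v x = 1 := by
  have h : x ∈ obpDomain v := fun k => k.elim0
  rw [obpDens, Set.indicator_of_mem h]
  simp [obpWt]

lemma measurable_obpDens (θ : ℝ) (n : ℕ) :
    Measurable fun z : (Fin (n + 1) → ℝ) × Tri n => obpDens θ z.1 z.2 := by
  induction n with
  | zero => simp_rw [obpDens_zero]; fun_prop
  | succ n ih =>
    simp_rw [obpDens_succ]
    have hL : Measurable fun z : (Fin (n + 2) → ℝ) × Tri (n + 1) => triLast z.2 :=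
      measurable_triLast.comp measurable_snd
    have hI : Measurable fun z : (Fin (n + 2) → ℝ) × Tri (n + 1) => triInit z.2 :=
      measurable_triInit.comp measurable_snd
    exact ((measurable_pairDens θ (n + 1)).comp (measurable_fst.prodMk hL)).mul
      (ih.comp (hL.prodMk hI))

lemma obpDens_eq_zero (θ : ℝ) {n : ℕ} {v : Fin (n + 1) → ℝ} (hv : ¬ StrictAnti v) (x : Tri n) :
    obpDens θ v x = 0 := by
  rcases n with _ | n
  · exact absurd (fun i j hij => absurd hij (by omega)) hv
  · refine Set.indicator_of_notMem (fun h => hv ?_) _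
    exact ((mem_obpDomain_succ v x).1 h).2.strictAnti_right

lemma lintegral_obpDens_succ (θ : ℝ) {n : ℕ} (v : Fin (n + 2) → ℝ) :
    ∫⁻ x, obpDens θ v x = ∫⁻ u, pairDens θ v u * ∫⁻ w, obpDens θ u w := by
  have hm : Measurable fun z : Tri n × (Fin (n + 1) → ℝ) => pairDens θ v z.2 * obpDens θ z.2 z.1 :=
    ((measurable_pairDens θ (n + 1)).comp (measurable_const.prodMk measurable_snd)).mul
      ((measurable_obpDens θ n).comp measurable_swap)
  simp_rw [obpDens_succ]
  rw [lintegral_tri_succ (F := fun w u => pairDens θ v u * obpDens θ u w) hm,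
    lintegral_lintegral_swap hm.aemeasurable]
  refine lintegral_congr fun u => lintegral_const_mul _ ?_
  exact (measurable_obpDens θ n).comp (measurable_const.prodMk measurable_id)

/-- The normalizing constant of the multivariate Bessel function. -/
def besselConst (θ : ℝ) (N : ℕ) : ℝ :=
  (∏ k : Fin N, Real.Gamma ((k.1 + 1) * θ)) / Real.Gamma θ ^ (N * (N + 1) / 2)

lemma besselConst_pos {θ : ℝ} (hθ : 0 < θ) (N : ℕ) : 0 < besselConst θ N :=
  div_pos (Finset.prod_pos fun k _ => Real.Gamma_pos_of_pos (by positivity))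
    (pow_pos (Real.Gamma_pos_of_pos hθ) _)

lemma besselConst_succ (θ : ℝ) (N : ℕ) :
    besselConst θ (N + 1) =
      besselConst θ N * (Real.Gamma ((N + 1) * θ) / Real.Gamma θ ^ (N + 1)) := by
  have h : (N + 1) * (N + 1 + 1) / 2 = N * (N + 1) / 2 + (N + 1) := by
    rw [show (N + 1) * (N + 1 + 1) = N * (N + 1) + (N + 1) * 2 by ring,
      Nat.add_mul_div_right _ _ two_pos]
  simp only [besselConst, Fin.prod_univ_castSucc, Fin.val_castSucc, Fin.val_last, h, pow_add]
  rw [mul_div_mul_comm]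

lemma lintegral_obpDens {θ : ℝ} (hθ : 0 < θ) {n : ℕ} {v : Fin (n + 1) → ℝ} (hv : StrictAnti v) :
    ∫⁻ x, obpDens θ v x =
      ENNReal.ofReal ((besselConst θ (n + 1))⁻¹ * vdm v ^ (2 * θ - 1)) := by
  induction n with
  | zero =>
    have hΓ := (Real.Gamma_pos_of_pos hθ).ne'
    simp [obpDens_zero, besselConst, vdm, hΓ, volume_pi]
  | succ n ih =>
    have hc := besselConst_pos hθ (n + 1)
    rw [lintegral_obpDens_succ]
    have key : ∀ u, pairDens θ v u * ∫⁻ w, obpDens θ u w =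
        {u | Interlaces u v}.indicator (fun u => ENNReal.ofReal (besselConst θ (n + 1))⁻¹ *
          ENNReal.ofReal (vdm u * ∏ s, ∏ r, |v s - u r| ^ (θ - 1))) u := by
      intro u
      by_cases h : Interlaces u v
      · have hu : 0 < vdm u := vdm_pos h.strictAnti_left.injective
        rw [pairDens, Set.indicator_of_mem (show u ∈ {u | Interlaces u v} from h),
          Set.indicator_of_mem (show u ∈ {u | Interlaces u v} from h), ih h.strictAnti_left, pairWt,
          ← ENNReal.ofReal_mul (by positivity), ← ENNReal.ofReal_mul (by positivity)]
        congr 1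
        have : vdm u ^ (2 - 2 * θ) * vdm u ^ (2 * θ - 1) = vdm u := by
          rw [← Real.rpow_add hu]; ring_nf; exact Real.rpow_one _
        linear_combination (besselConst θ (n + 1))⁻¹ * (∏ s, ∏ r, |v s - u r| ^ (θ - 1)) * this
      · rw [pairDens, Set.indicator_of_notMem (show u ∉ {u | Interlaces u v} from h),
          Set.indicator_of_notMem (show u ∉ {u | Interlaces u v} from h), zero_mul]
    simp_rw [key]
    rw [lintegral_indicator (measurableSet_interlaces_left v),
      lintegral_const_mul' _ _ ENNReal.ofReal_ne_top, lintegral_interlaces_left hθ hv,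
      ← ENNReal.ofReal_mul (by positivity), besselConst_succ θ (n + 1), mul_inv, inv_div, mul_assoc]

/-- The density of the Gaussian beta ensemble after one factor `vdm v ^ (2 * θ - 1)` is absorbed
by the multivariate Bessel function. -/
def topDens (θ : ℝ) {n : ℕ} (v : Fin n → ℝ) : ℝ≥0∞ :=
  ENNReal.ofReal (vdm v * Real.exp (-(θ / 2) * ∑ i, v i ^ 2))

lemma measurable_topDens (θ : ℝ) (n : ℕ) : Measurable (topDens θ (n := n)) :=
  (measurable_vdm.mul (by fun_prop)).ennreal_ofReal

lemma lintegral_mul_topDens_mul_pairDens {θ : ℝ} (hθ : 0 < θ) {n : ℕ} {u : Fin n → ℝ}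
    (hu : StrictAnti u) {f : ℝ → ℝ≥0∞} (hf : Measurable f) :
    ∫⁻ v, f (∑ s, v s - ∑ r, u r) * (topDens θ v * pairDens θ v u) =
      ENNReal.ofReal ((Real.Gamma θ / θ ^ θ) ^ n * √(2 * Real.pi * θ⁻¹)) * topDens θ u *
        ∫⁻ c, f c ∂ProbabilityTheory.gaussianReal 0 (Real.toNNReal θ⁻¹) := by
  have hp : 0 < vdm u := vdm_pos hu.injective
  have key : ∀ v, f (∑ s, v s - ∑ r, u r) * (topDens θ v * pairDens θ v u) =
      {v | Interlaces u v}.indicator (fun v => ENNReal.ofReal (vdm u ^ (2 - 2 * θ)) *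
        (f (∑ s, v s - ∑ r, u r) * ENNReal.ofReal (vdm v *
          (∏ s, ∏ r, |v s - u r| ^ (θ - 1)) * Real.exp (-(θ / 2) * ∑ s, v s ^ 2)))) v := by
    intro v
    by_cases h : Interlaces u v
    · have hv := vdm_nonneg v
      rw [pairDens, Set.indicator_of_mem (show u ∈ {u | Interlaces u v} from h),
        Set.indicator_of_mem (show v ∈ {v | Interlaces u v} from h), topDens, pairWt,
        ← ENNReal.ofReal_mul (by positivity), mul_left_comm (ENNReal.ofReal _),
        ← ENNReal.ofReal_mul (by positivity)]
      congr 2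
      ring
    · rw [pairDens, Set.indicator_of_notMem (show u ∉ {u | Interlaces u v} from h),
        Set.indicator_of_notMem (show v ∉ {v | Interlaces u v} from h), mul_zero, mul_zero]
  have hΓ := Real.Gamma_pos_of_pos hθ
  simp_rw [key]
  rw [lintegral_indicator (measurableSet_interlaces_right u),
    lintegral_const_mul' _ _ ENNReal.ofReal_ne_top, lintegral_interlaces_right hθ hu hf, ← mul_assoc,
    topDens, ← ENNReal.ofReal_mul (by positivity), ← ENNReal.ofReal_mul (by positivity)]
  congr 2
  have : vdm u ^ (2 - 2 * θ) * vdm u ^ (2 * θ - 1) = vdm u := by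
    rw [← Real.rpow_add hp]; ring_nf; exact Real.rpow_one _
  linear_combination ((Real.Gamma θ / θ ^ θ) ^ n * √(2 * Real.pi * θ⁻¹) *
    Real.exp (-(θ / 2) * ∑ i, u i ^ 2)) * this

lemma lintegral_lintegral_lintegral_reverse {α β γ : Type*} [MeasurableSpace α]
    [MeasurableSpace β] [MeasurableSpace γ] {μ : Measure α} {ν : Measure β} {ρ : Measure γ}
    [SFinite μ] [SFinite ν] [SFinite ρ] {H : α → β → γ → ℝ≥0∞}
    (hH : Measurable fun z : α × β × γ => H z.1 z.2.1 z.2.2) :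
    ∫⁻ a, ∫⁻ c, ∫⁻ b, H a b c ∂ν ∂ρ ∂μ = ∫⁻ b, ∫⁻ c, ∫⁻ a, H a b c ∂μ ∂ρ ∂ν := by
  calc ∫⁻ a, ∫⁻ c, ∫⁻ b, H a b c ∂ν ∂ρ ∂μ
      = ∫⁻ a, ∫⁻ p : β × γ, H a p.1 p.2 ∂ν.prod ρ ∂μ := by
        refine lintegral_congr fun a => ?_
        rw [lintegral_prod_symm]
        exact (hH.comp measurable_prodMk_left).aemeasurable
    _ = ∫⁻ p : β × γ, ∫⁻ a, H a p.1 p.2 ∂μ ∂ν.prod ρ := lintegral_lintegral_swap hH.aemeasurable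
    _ = _ := lintegral_prod _ hH.lintegral_prod_left'.aemeasurable

lemma measurable_finSnoc_right {n : ℕ} (t : Fin n → ℝ) :
    Measurable fun c : ℝ => (Fin.snoc t c : Fin (n + 1) → ℝ) :=
  measurable_finSnoc.comp measurable_prodMk_left

lemma lintegral_lintegral_triIncr_succ (θ : ℝ) {n : ℕ} {f : (Fin (n + 2) → ℝ) → ℝ≥0∞}
    (hf : Measurable f) :
    ∫⁻ v, ∫⁻ x, f (triIncr v x) * (topDens θ v * obpDens θ v x) =
      ∫⁻ u, ∫⁻ w, obpDens θ u w * ∫⁻ v : Fin (n + 2) → ℝ,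
        f (Fin.snoc (triIncr u w) (∑ s, v s - ∑ r, u r)) * (topDens θ v * pairDens θ v u) := by
  have hs : Measurable fun z : (Fin (n + 2) → ℝ) × (Fin (n + 1) → ℝ) × Tri n =>
      f (Fin.snoc (triIncr z.2.1 z.2.2) (∑ s, z.1 s - ∑ r, z.2.1 r)) :=
    hf.comp (measurable_finSnoc.comp
      (((measurable_triIncr n).comp measurable_snd).prodMk (by fun_prop)))
  have ht : Measurable fun z : (Fin (n + 2) → ℝ) × (Fin (n + 1) → ℝ) × Tri n =>
      topDens θ z.1 * pairDens θ z.1 z.2.1 :=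
    ((measurable_topDens θ _).comp measurable_fst).mul
      ((measurable_pairDens θ (n + 1)).comp (measurable_fst.prodMk measurable_snd.fst))
  have ho : Measurable fun z : (Fin (n + 2) → ℝ) × (Fin (n + 1) → ℝ) × Tri n =>
      obpDens θ z.2.1 z.2.2 := (measurable_obpDens θ n).comp measurable_snd
  let H : (Fin (n + 2) → ℝ) → (Fin (n + 1) → ℝ) → Tri n → ℝ≥0∞ := fun v u w => obpDens θ u w *
    (f (Fin.snoc (triIncr u w) (∑ s, v s - ∑ r, u r)) * (topDens θ v * pairDens θ v u))
  have hH : Measurable fun z : (Fin (n + 2) → ℝ) × (Fin (n + 1) → ℝ) × Tri n =>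
      H z.1 z.2.1 z.2.2 := ho.mul (hs.mul ht)
  refine Eq.trans (lintegral_congr fun v => ?_)
    ((lintegral_lintegral_lintegral_reverse (μ := volume) (ν := volume)
      (ρ := volume) (H := H) hH).trans ?_)
  · refine Eq.trans (lintegral_congr fun x => ?_) (lintegral_tri_succ (F := fun w u => H v u w) ?_)
    · rw [triIncr_succ, obpDens_succ]
      ring
    · exact hH.comp (measurable_const.prodMk measurable_swap)
  · refine lintegral_congr fun u => lintegral_congr fun w => lintegral_const_mul _ ?_
    refine Measurable.mul ?_ (Measurable.mul (measurable_topDens θ _) ?_)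
    · exact hf.comp ((measurable_finSnoc_right _).comp (by fun_prop))
    · exact (measurable_pairDens θ (n + 1)).comp measurable_prodMk_right

lemma lintegral_triIncr_zero {θ : ℝ} (hθ : 0 < θ) {f : (Fin 1 → ℝ) → ℝ≥0∞} (hf : Measurable f) :
    ∫⁻ v, ∫⁻ x : Tri 0, f (triIncr v x) * (topDens θ v * obpDens θ v x) =
      ENNReal.ofReal (√(2 * Real.pi * θ⁻¹)) *
        ∫⁻ t, f t ∂Measure.pi fun _ => ProbabilityTheory.gaussianReal 0 (Real.toNNReal θ⁻¹) := by
  have hi : ∀ (v : Fin 1 → ℝ) (x : Tri 0), triIncr v x = v :=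
    fun v x => funext fun k => by
      obtain rfl : k = 0 := Subsingleton.elim (α := Fin 1) _ _
      exact triIncr_zero v x 0
  have hone : ∀ (w : Fin 0 → ℝ) (v : Fin 1 → ℝ), (Fin.snoc w (v 0) : Fin 1 → ℝ) = v :=
    fun w v => funext fun k => by
      obtain rfl : k = Fin.last 0 := Subsingleton.elim (α := Fin 1) _ _
      exact Fin.snoc_last _ _
  have hu : ∀ v : Fin 1 → ℝ, pairDens θ v (0 : Fin 0 → ℝ) = 1 := fun v => by
    rw [pairDens, Set.indicator_of_mem (show (0 : Fin 0 → ℝ) ∈ {u | Interlaces u v} from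
      fun i => i.elim0)]
    simp [pairWt, vdm]
  have ht : topDens θ (0 : Fin 0 → ℝ) = 1 := by simp [topDens, vdm]
  have h := lintegral_mul_topDens_mul_pairDens hθ (u := (0 : Fin 0 → ℝ)) (fun i => i.elim0)
    (f := fun c => f (Fin.snoc (0 : Fin 0 → ℝ) c))
    (hf.comp (measurable_finSnoc_right _))
  have hpi := lintegral_pi_snoc (n := 0) (ProbabilityTheory.gaussianReal 0 (Real.toNNReal θ⁻¹))
    (F := fun w c => f (Fin.snoc w c)) (hf.comp measurable_finSnoc)
  have hsum : ∀ v : Fin (0 + 1) → ℝ, ∑ s, v s - ∑ r : Fin 0, (0 : Fin 0 → ℝ) r = v 0 :=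
    fun v => by simp
  simp only [hsum] at h
  change ∫⁻ v : Fin 1 → ℝ, f (Fin.snoc (0 : Fin 0 → ℝ) (v 0)) * _ = _ at h
  change ∫⁻ q : Fin 1 → ℝ, f (Fin.snoc (fun r => q r.castSucc) (q 0))
    ∂Measure.pi (fun _ => _) = _ at hpi
  simp only [hone, hu, mul_one, ht, pow_zero, one_mul] at h
  simp only [hone] at hpi
  rw [hpi]
  have hvol : (volume : Measure (Tri 0)) Set.univ = 1 := by simp [volume_pi]
  simp only [hi, obpDens_zero, mul_one, lintegral_const, hvol, h]
  simp only [Subsingleton.elim _ (0 : Fin 0 → ℝ), lintegral_const, measure_univ, mul_one]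

/-- Under the joint density of the Gaussian beta corners process, the increments of the level
sums are independent centred Gaussians of variance `θ⁻¹`. -/
lemma exists_lintegral_triIncr_eq {θ : ℝ} (hθ : 0 < θ) (n : ℕ) :
    ∃ C : ℝ, 0 < C ∧ ∀ f : (Fin (n + 1) → ℝ) → ℝ≥0∞, Measurable f →
      ∫⁻ v, ∫⁻ x, f (triIncr v x) * (topDens θ v * obpDens θ v x) = ENNReal.ofReal C *
        ∫⁻ t, f t ∂Measure.pi fun _ => ProbabilityTheory.gaussianReal 0 (Real.toNNReal θ⁻¹) := by
  have hΓ := Real.Gamma_pos_of_pos hθ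
  have hsnoc : ∀ {n : ℕ} (q : Fin (n + 1) → ℝ),
      (Fin.snoc (fun r => q r.castSucc) (q (Fin.last n)) : Fin (n + 1) → ℝ) = q :=
    fun q => Fin.snoc_init_self q
  induction n with
  | zero =>
    refine ⟨√(2 * Real.pi * θ⁻¹), by positivity, fun f hf => ?_⟩
    exact lintegral_triIncr_zero hθ hf
  | succ n ih =>
    obtain ⟨C, hC, ih⟩ := ih
    refine ⟨((Real.Gamma θ / θ ^ θ) ^ (n + 1) * √(2 * Real.pi * θ⁻¹)) * C, by positivity,
      fun f hf => ?_⟩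
    set γ := ProbabilityTheory.gaussianReal 0 (Real.toNNReal θ⁻¹)
    set K := (Real.Gamma θ / θ ^ θ) ^ (n + 1) * √(2 * Real.pi * θ⁻¹)
    have hg : Measurable fun t : Fin (n + 1) → ℝ => ∫⁻ c, f (Fin.snoc t c) ∂γ :=
      (hf.comp measurable_finSnoc).lintegral_prod_right'
    have hpi := lintegral_pi_snoc γ (F := fun w c => f (Fin.snoc w c)) (hf.comp measurable_finSnoc)
    simp only [hsnoc] at hpi
    rw [lintegral_lintegral_triIncr_succ θ hf, hpi, ENNReal.ofReal_mul (by positivity), mul_assoc,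
      ← ih _ hg, ← lintegral_const_mul' _ _ ENNReal.ofReal_ne_top]
    refine lintegral_congr fun u => ?_
    rw [← lintegral_const_mul' _ _ ENNReal.ofReal_ne_top]
    refine lintegral_congr fun w => ?_
    by_cases hu : StrictAnti u
    · have := lintegral_mul_topDens_mul_pairDens hθ hu
        (f := fun c => f (Fin.snoc (triIncr u w) c))
        (hf.comp (measurable_finSnoc_right _))
      rw [this]
      ring
    · simp [obpDens_eq_zero θ hu]

lemma integrable_cexp_sum_pi_gaussianReal {n : ℕ} (y : Fin n → ℂ) (s : NNReal) :
    Integrable (fun t : Fin n → ℝ => Complex.exp (∑ k, y k * (t k : ℂ)))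
      (Measure.pi fun _ => ProbabilityTheory.gaussianReal 0 s) := by
  simp_rw [Complex.exp_sum]
  exact Integrable.fintype_prod (f := fun k (t : ℝ) => Complex.exp (y k * (t : ℂ))) fun k =>
    ProbabilityTheory.integrable_cexp_mul_of_re_mem_integrableExpSet (X := id) aemeasurable_id
      (by simp)

lemma integral_cexp_sum_pi_gaussianReal {n : ℕ} (y : Fin n → ℂ) (s : NNReal) :
    ∫ t : Fin n → ℝ, Complex.exp (∑ k, y k * (t k : ℂ))
      ∂(Measure.pi fun _ => ProbabilityTheory.gaussianReal 0 s) =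
      Complex.exp (s / 2 * ∑ k, y k ^ 2) := by
  simp_rw [Complex.exp_sum]
  rw [integral_fintype_prod_eq_prod (fun k (t : ℝ) => Complex.exp (y k * (t : ℂ))), Finset.mul_sum,
    Complex.exp_sum]
  refine Finset.prod_congr rfl fun k _ => ?_
  refine (ProbabilityTheory.complexMGF_id_gaussianReal (μ := 0) (v := s) (y k)).trans ?_
  congr 1
  push_cast
  ring

/-- If `T` pushes the measure with density `d` forward to a multiple of `P`, integrals against
`d` of functions of `T` are integrals against `P`. -/
lemma integral_integral_comp_mul_toReal {α β γ : Type*} [MeasurableSpace α] [MeasurableSpace β]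
    [MeasurableSpace γ] {μ : Measure α} {ν : Measure β} [SFinite μ] [SFinite ν] {P : Measure γ}
    {C : ℝ} (hC : 0 ≤ C) {d : α × β → ℝ≥0∞} (hd : Measurable d) (hd' : ∀ z, d z < ⊤)
    {T : α × β → γ} (hT : Measurable T)
    (h : ∀ f : γ → ℝ≥0∞, Measurable f →
      ∫⁻ a, ∫⁻ b, f (T (a, b)) * d (a, b) ∂ν ∂μ = ENNReal.ofReal C * ∫⁻ t, f t ∂P)
    {g : γ → ℂ} (hg : Integrable g P) :
    ∫ a, ∫ b, g (T (a, b)) * ((d (a, b)).toReal : ℂ) ∂ν ∂μ = C * ∫ t, g t ∂P := by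
  have hmap : ((μ.prod ν).withDensity d).map T = ENNReal.ofReal C • P := by
    ext s hs
    have hi : Measurable (s.indicator (1 : γ → ℝ≥0∞)) := measurable_one.indicator hs
    have := h _ hi
    rw [lintegral_indicator_one hs] at this
    rw [Measure.map_apply hT hs, withDensity_apply _ (hT hs), ← lintegral_indicator (hT hs),
      Measure.smul_apply, smul_eq_mul, ← this, lintegral_prod _ (hd.indicator (hT hs)).aemeasurable]
    refine lintegral_congr fun a => lintegral_congr fun b => ?_
    by_cases hab : T (a, b) ∈ s
    · rw [Set.indicator_of_mem hab, Set.indicator_of_mem (show (a, b) ∈ T ⁻¹' s from hab),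
        Pi.one_apply, one_mul]
    · rw [Set.indicator_of_notMem hab, Set.indicator_of_notMem (show (a, b) ∉ T ⁻¹' s from hab),
        zero_mul]
  have hgC : Integrable g (ENNReal.ofReal C • P) := hg.smul_measure ENNReal.ofReal_ne_top
  have hcomp : ∀ z, g (T z) * ((d z).toReal : ℂ) = (d z).toReal • (g ∘ T) z := fun z => by
    rw [Complex.real_smul, mul_comm, Function.comp_apply]
  have hInt : Integrable (fun z => g (T z) * ((d z).toReal : ℂ)) (μ.prod ν) := by
    rw [funext hcomp, ← integrable_withDensity_iff_integrable_smul' hd (ae_of_all _ hd'),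
      ← integrable_map_measure (hmap ▸ hgC.aestronglyMeasurable) hT.aemeasurable, hmap]
    exact hgC
  rw [← integral_prod (fun z => g (T z) * ((d z).toReal : ℂ)) hInt, funext hcomp,
    ← integral_withDensity_eq_integral_toReal_smul hd (ae_of_all _ hd')]
  change ∫ z, g (T z) ∂_ = _
  rw [← integral_map hT.aemeasurable (hmap ▸ hgC.aestronglyMeasurable), hmap, integral_smul_measure,
    ENNReal.toReal_ofReal hC, Complex.real_smul]

lemma measurableSet_obpDomain {n : ℕ} (v : Fin (n + 1) → ℝ) : MeasurableSet (obpDomain v) := by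
  have : obpDomain v = ⋂ k : Fin n, (fun x : Tri n => (x k, lvl v x (k.1 + 1)
      (by have := k.isLt; omega))) ⁻¹' {p | Interlaces p.1 p.2} := by
    ext x
    simp only [Set.mem_iInter]
    rfl
  rw [this]
  refine MeasurableSet.iInter fun k => measurableSet_interlaces.preimage ?_
  refine (measurable_pi_apply k).prodMk ?_
  unfold lvl
  split_ifs <;> fun_prop

lemma measurableSet_weylChamber (n : ℕ) : MeasurableSet (weylChamber n) := by
  simp only [weylChamber, Set.ofPred_forall]
  exact MeasurableSet.iInter fun i => MeasurableSet.iInter fun j => MeasurableSet.iInter fun _ =>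
    measurableSet_le (measurable_pi_apply j) (measurable_pi_apply i)

lemma gbeWt_eq (θ : ℝ) {n : ℕ} (v : Fin n → ℝ) :
    gbeWt θ n v = vdm v ^ (2 * θ) * Real.exp (-(θ / 2) * ∑ i, v i ^ 2) := by
  rw [gbeWt, prod_rpow_eq_vdm_rpow]

/-- The density of the Gaussian beta ensemble, extended by zero off the Weyl chamber. -/
def gbeDens (θ : ℝ) {n : ℕ} (v : Fin n → ℝ) : ℝ := (weylChamber n).indicator (gbeWt θ n) v

lemma measurable_gbeDens (θ : ℝ) (n : ℕ) : Measurable (gbeDens θ (n := n)) := by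
  refine Measurable.indicator ?_ (measurableSet_weylChamber n)
  simp_rw [funext (gbeWt_eq θ (n := n))]
  exact (measurable_vdm.pow_const _).mul (by fun_prop)

lemma gbeDens_nonneg (θ : ℝ) {n : ℕ} (v : Fin n → ℝ) : 0 ≤ gbeDens θ v :=
  Set.indicator_nonneg (fun v _ => by
    rw [gbeWt_eq]; exact mul_nonneg (Real.rpow_nonneg (vdm_nonneg v) _) (Real.exp_nonneg _)) v

lemma gbeDens_of_strictAnti (θ : ℝ) {n : ℕ} {v : Fin n → ℝ} (hv : StrictAnti v) :
    gbeDens θ v = vdm v ^ (2 * θ) * Real.exp (-(θ / 2) * ∑ i, v i ^ 2) := by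
  rw [gbeDens, Set.indicator_of_mem (show v ∈ weylChamber n from fun i j hij => hv.antitone hij),
    gbeWt_eq]

lemma gbeDens_of_not_strictAnti {θ : ℝ} (hθ : 0 < θ) {n : ℕ} {v : Fin n → ℝ}
    (hv : ¬ StrictAnti v) : gbeDens θ v = 0 := by
  by_cases h : v ∈ weylChamber n
  · have h0 : vdm v = 0 := by
      simp only [StrictAnti, not_forall, not_lt] at hv
      obtain ⟨i, j, hij, hle⟩ := hv
      refine Finset.prod_eq_zero (Finset.mem_univ i) (Finset.prod_eq_zero (Finset.mem_univ j) ?_)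
      rw [if_pos hij, le_antisymm hle (h i j hij.le), sub_self, abs_zero]
    rw [gbeDens, Set.indicator_of_mem h, gbeWt_eq, h0, Real.zero_rpow (by positivity), zero_mul]
  · exact Set.indicator_of_notMem h _

lemma ofReal_gbeDens {θ : ℝ} (hθ : 0 < θ) {n : ℕ} (v : Fin (n + 1) → ℝ) :
    ENNReal.ofReal (gbeDens θ v) =
      ENNReal.ofReal (besselConst θ (n + 1)) * ∫⁻ x, topDens θ v * obpDens θ v x := by
  by_cases hv : StrictAnti v
  · have hp := vdm_pos hv.injective
    have hc := besselConst_pos hθ (n + 1)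
    rw [topDens, lintegral_const_mul' _ _ ENNReal.ofReal_ne_top, lintegral_obpDens hθ hv,
      ← ENNReal.ofReal_mul (by positivity), ← ENNReal.ofReal_mul hc.le, gbeDens_of_strictAnti θ hv]
    congr 1
    have : vdm v * vdm v ^ (2 * θ - 1) = vdm v ^ (2 * θ) := by
      rw [mul_comm, ← Real.rpow_add_one hp.ne', sub_add_cancel]
    rw [← this]
    field_simp
  · simp [gbeDens_of_not_strictAnti hθ hv, obpDens_eq_zero θ hv]

lemma gbeDens_smul_MBF {θ : ℝ} (hθ : 0 < θ) {n : ℕ} (v : Fin (n + 1) → ℝ) (y : Fin (n + 1) → ℂ) :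
    gbeDens θ v • MBF θ v y = besselConst θ (n + 1) *
      ∫ x, Complex.exp (∑ k, y k * (triIncr v x k : ℂ)) *
        ((topDens θ v * obpDens θ v x).toReal : ℂ) := by
  by_cases hv : StrictAnti v
  · have hp := vdm_pos hv.injective
    have hx : ∀ x : Tri n, Complex.exp (∑ k, y k * (triIncr v x k : ℂ)) *
        ((topDens θ v * obpDens θ v x).toReal : ℂ) =
        ((vdm v * Real.exp (-(θ / 2) * ∑ i, v i ^ 2) : ℝ) : ℂ) *
          (obpDomain v).indicator (fun x => Complex.exp (∑ k, y k * (triIncr v x k : ℂ)) *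
            (obpWt θ v x : ℂ)) x := by
      intro x
      rw [ENNReal.toReal_mul, topDens, ENNReal.toReal_ofReal (by positivity), obpDens]
      by_cases h : x ∈ obpDomain v
      · rw [Set.indicator_of_mem h, Set.indicator_of_mem h,
          ENNReal.toReal_ofReal (obpWt_nonneg _ _ _)]
        push_cast
        ring
      · rw [Set.indicator_of_notMem h, Set.indicator_of_notMem h]
        simp
    have hr : ((vdm v ^ (2 * θ) : ℝ) : ℂ) * ((vdm v ^ (1 - 2 * θ) : ℝ) : ℂ) = (vdm v : ℂ) := by
      rw [← Complex.ofReal_mul, ← Real.rpow_add hp, add_sub_cancel, Real.rpow_one]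
    simp_rw [hx]
    rw [integral_const_mul]
    erw [integral_indicator (measurableSet_obpDomain v)]
    rw [gbeDens_of_strictAnti θ hv, MBF, prod_rpow_eq_vdm_rpow, Complex.real_smul]
    change _ * ((besselConst θ (n + 1) : ℂ) * _ * ∫ x in obpDomain v,
      Complex.exp (∑ k, y k * (triIncr v x k : ℂ)) * (obpWt θ v x : ℂ)) = _
    rw [Complex.ofReal_mul, Complex.ofReal_mul, ← hr]
    ring
  · simp [gbeDens_of_not_strictAnti hθ hv, obpDens_eq_zero θ hv]

lemma integral_gbeWt_eq (θ : ℝ) (n : ℕ) :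
    ∫ v in weylChamber n, gbeWt θ n v = (∫⁻ v, ENNReal.ofReal (gbeDens θ (n := n) v)).toReal := by
  rw [← integral_indicator (measurableSet_weylChamber n)]
  exact integral_eq_lintegral_of_nonneg_ae (ae_of_all _ (gbeDens_nonneg θ))
    (measurable_gbeDens θ n).aestronglyMeasurable

lemma integral_gbe (θ : ℝ) (n : ℕ) (g : (Fin n → ℝ) → ℂ) :
    ∫ v, g v ∂gbe θ n =
      ((∫⁻ v, ENNReal.ofReal (gbeDens θ (n := n) v)).toReal : ℂ)⁻¹ * ∫ v, gbeDens θ v • g v := by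
  have hd : ∀ v : Fin n → ℝ, (weylChamber n).indicator (gbeWt θ n) v = gbeDens θ v := fun _ => rfl
  simp_rw [gbe, hd]
  rw [integral_smul_measure, integral_gbeWt_eq, ENNReal.toReal_inv,
    ENNReal.toReal_ofReal ENNReal.toReal_nonneg, integral_withDensity_eq_integral_toReal_smul
      (measurable_gbeDens θ n).ennreal_ofReal (ae_of_all _ fun _ => ENNReal.ofReal_lt_top),
    Complex.real_smul, Complex.ofReal_inv]
  simp_rw [ENNReal.toReal_ofReal (gbeDens_nonneg θ _)]

/-- (Proposition 4.2, Macdonald–Mehta integral) The Bessel observable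
of the Gaussian beta ensemble:
`𝔼_{𝕄^{(θ)}_m}[𝓑_{(x₁,…,x_m)}(y₁,…,y_m;θ)] = exp((1/2θ) ∑ y_i²)`. -/
theorem mbf_observable_gbe
    (θ : ℝ) (hθ : 0 < θ) (m : ℕ) (hm : 1 ≤ m) (y : Fin m → ℂ) :
    ∫ v, MBF θ v y ∂(gbe θ m) =
      Complex.exp (((1 / (2 * θ) : ℝ) : ℂ) * ∑ i, y i ^ 2) := by
  obtain ⟨n, rfl⟩ : ∃ n, m = n + 1 := ⟨m - 1, by omega⟩
  obtain ⟨C, hC, h⟩ := exists_lintegral_triIncr_eq hθ n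
  have hc := besselConst_pos hθ (n + 1)
  have hd : Measurable fun z : (Fin (n + 1) → ℝ) × Tri n => topDens θ z.1 * obpDens θ z.1 z.2 :=
    ((measurable_topDens θ _).comp measurable_fst).mul (measurable_obpDens θ n)
  have hd' : ∀ z : (Fin (n + 1) → ℝ) × Tri n, topDens θ z.1 * obpDens θ z.1 z.2 < ⊤ := fun z =>
    ENNReal.mul_lt_top ENNReal.ofReal_lt_top
      ((Set.indicator_le_self _ _ _).trans_lt ENNReal.ofReal_lt_top)
  have hZ : (∫⁻ v, ENNReal.ofReal (gbeDens θ (n := n + 1) v)).toReal =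
      besselConst θ (n + 1) * C := by
    have h1 := h 1 measurable_one
    simp only [Pi.one_apply, one_mul, lintegral_one, measure_univ, mul_one] at h1
    simp_rw [ofReal_gbeDens hθ]
    rw [lintegral_const_mul' _ _ ENNReal.ofReal_ne_top, h1, ENNReal.toReal_mul,
      ENNReal.toReal_ofReal hc.le, ENNReal.toReal_ofReal hC.le]
  have key := integral_integral_comp_mul_toReal hC.le hd hd' (measurable_triIncr n) h
    (integrable_cexp_sum_pi_gaussianReal y (Real.toNNReal θ⁻¹))
  rw [integral_gbe, hZ]
  simp_rw [gbeDens_smul_MBF hθ]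
  rw [integral_const_mul, key, integral_cexp_sum_pi_gaussianReal, Real.coe_toNNReal _ (by positivity)]
  have hc' : (besselConst θ (n + 1) : ℂ) ≠ 0 := by exact_mod_cast hc.ne'
  have hC' : (C : ℂ) ≠ 0 := by exact_mod_cast hC.ne'
  rw [Complex.ofReal_mul, ← mul_assoc (besselConst θ (n + 1) : ℂ), inv_mul_cancel_left₀
    (mul_ne_zero hc' hC')]
  congr 2
  push_cast
  rw [one_div, mul_inv, mul_comm, div_eq_mul_inv]

end
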